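/- Let d ≥ 1, m ∈ ℝ, and a ∈ S^m_{1,1}. Define the near-diagonal part S^near_a f := Σ_{j,k≥0, |j−k|≤2} T_{a_{j,k}} f for Schwartz f. Then there is a constant C such that ‖S^near_a f‖_{bmo} ≤ C ‖f‖_{F_∞^{m,1}} for every Schwartz function f. -/

import Mathlib

noncomputable section

open MeasureTheory SchwartzMap Complex RealInnerProductSpace Filter
open scoped ENNReal NNReal ContDiff SchwartzMap

/-- Euclidean space `ℝ^d`. -/
abbrev RD (d : ℕ) : Type := EuclideanSpace ℝ (Fin d)

/-- Tempered distributions on `ℝ^d`. -/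
abbrev TD (d : ℕ) : Type := 𝓢(RD d, ℂ) →L[ℂ] ℂ

/-- Fourier transform of a Schwartz function (with the convention
`f̂(ξ) = ∫ f(x) e^{-2πi⟨x,ξ⟩} dx`). -/
def fourierS {d : ℕ} (f : 𝓢(RD d, ℂ)) : 𝓢(RD d, ℂ) :=
  SchwartzMap.fourierTransformCLM ℂ f

/-- Hörmander symbol class `S^m_{1,1}`: `a` is smooth and
`‖∂_ξ^α ∂_x^β a(x,ξ)‖ ≤ c_{α,β} (1+‖ξ‖)^{m-|α|+|β|}` for all orders of derivatives. -/
def IsSymbolS11 (d : ℕ) (m : ℝ) (a : RD d → RD d → ℂ) : Prop :=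
  ContDiff ℝ ∞ (fun p : RD d × RD d => a p.1 p.2) ∧
  ∀ α β : ℕ, ∃ c : ℝ, ∀ x ξ : RD d,
    ‖iteratedFDeriv ℝ α (fun ξ' => iteratedFDeriv ℝ β (fun x' => a x' ξ') x) ξ‖
      ≤ c * (1 + ‖ξ‖) ^ (m - (α : ℝ) + (β : ℝ))

/-- The pseudo-differential operator `T_a f(x) = ∫ a(x,ξ) f̂(ξ) e^{2πi⟨x,ξ⟩} dξ`
acting on a Schwartz function `f`. -/
def pdo {d : ℕ} (a : RD d → RD d → ℂ) (f : 𝓢(RD d, ℂ)) (x : RD d) : ℂ :=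
  ∫ ξ, a x ξ * fourierS f ξ * Complex.exp (2 * Real.pi * Complex.I * ((⟪x, ξ⟫ : ℝ) : ℂ))

/-- Littlewood–Paley data: a Schwartz function `φ` with `φ̂` supported in
`{1/2 ≤ |ξ| ≤ 2}` and `Σ_{k∈ℤ} φ̂(2^{-k}ξ) = 1` for `ξ ≠ 0`, together with the
low-frequency piece `Φ` determined by `Φ̂ = 1 - Σ_{k≥1} φ̂(2^{-k}·)`. -/
structure LPData (d : ℕ) where
  φ : 𝓢(RD d, ℂ)
  Φ : 𝓢(RD d, ℂ)
  supp_φ : ∀ ξ : RD d, fourierS φ ξ ≠ 0 → 1/2 ≤ ‖ξ‖ ∧ ‖ξ‖ ≤ 2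
  sum_φ : ∀ ξ : RD d, ξ ≠ 0 → HasSum (fun k : ℤ => fourierS φ ((2:ℝ)^(-k) • ξ)) 1
  Φ_def : ∀ ξ : RD d, fourierS Φ ξ = 1 - ∑' k : ℕ, fourierS φ (((2:ℝ)^(k+1))⁻¹ • ξ)

/-- The Littlewood–Paley convolution kernel: `Φ` for `k = 0` and
`φ_k = 2^{kd} φ(2^k ·)` for `k ≥ 1`. -/
def LPkernel {d : ℕ} (D : LPData d) : ℕ → RD d → ℂ
  | 0, x => D.Φ x
  | (k+1), x => (((2:ℝ)^((k+1) * d) : ℝ) : ℂ) * D.φ ((2:ℝ)^(k+1) • x)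

/-- The Fourier transform of the `k`-th Littlewood–Paley kernel, i.e. `φ̂_k = φ̂(2^{-k}·)`
for `k ≥ 1` and `Φ̂` for `k = 0`. -/
def LPhat {d : ℕ} (D : LPData d) : ℕ → RD d → ℂ
  | 0, ξ => fourierS D.Φ ξ
  | (k+1), ξ => fourierS D.φ (((2:ℝ)^(k+1))⁻¹ • ξ)

/-- Littlewood–Paley operator `Π_k g = φ_k ∗ g` (with `φ_0 := Φ`) acting on functions. -/
def LP {d : ℕ} (D : LPData d) (k : ℕ) (g : RD d → ℂ) (x : RD d) : ℂ :=
  ∫ y, LPkernel D k y * g (x - y)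

/-- `Π*_k = Π_{k-1} + Π_k + Π_{k+1}` (with the convention `φ_{-1} := 0`). -/
def LPstar {d : ℕ} (D : LPData d) (k : ℕ) (g : RD d → ℂ) (x : RD d) : ℂ :=
  (if k = 0 then 0 else LP D (k-1) g x) + LP D k g x + LP D (k+1) g x

open Classical in
/-- Pairing of a tempered distribution with a plain function: it gives `u ψ` if the
function is (the coercion of) a Schwartz function `ψ`, and `0` otherwise. -/
def pairing {d : ℕ} (u : TD d) (g : RD d → ℂ) : ℂ :=
  if h : ∃ ψ : 𝓢(RD d, ℂ), ⇑ψ = g then u h.choose else 0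

/-- Fourier transform of a tempered distribution, `⟨û, ψ⟩ = ⟨u, ψ̂⟩`. -/
def fourierTD {d : ℕ} (u : TD d) : TD d :=
  u.comp (SchwartzMap.fourierTransformCLM ℂ)

/-- Littlewood–Paley operator on tempered distributions:
`Π_k u (x) = ⟨u, φ_k(x - ·)⟩`. -/
def LPdist {d : ℕ} (D : LPData d) (k : ℕ) (u : TD d) (x : RD d) : ℂ :=
  pairing u (fun y => LPkernel D k (x - y))

/-- The symbol `a_{j,k}(x,ξ) = (φ_j ∗ a(·,ξ))(x) · φ̂_k(ξ)` (with `Φ` replacing `φ_0`). -/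
def symbolPiece {d : ℕ} (D : LPData d) (a : RD d → RD d → ℂ) (j k : ℕ)
    (x ξ : RD d) : ℂ :=
  (∫ y, LPkernel D j y * a (x - y) ξ) * LPhat D k ξ

/-- `T_{a_{j,k}} u (x) = ⟨û, a_{j,k}(x,·) e^{2πi⟨x,·⟩}⟩` for a tempered distribution `u`. -/
def pdoPieceD {d : ℕ} (D : LPData d) (a : RD d → RD d → ℂ) (j k : ℕ)
    (u : TD d) (x : RD d) : ℂ :=
  pairing (fourierTD u)
    (fun ξ => symbolPiece D a j k x ξ * Complex.exp (2 * Real.pi * Complex.I * ((⟪x, ξ⟫ : ℝ) : ℂ)))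

/-- Partial sums `Σ_{j=0}^N Σ_{k=0}^N T_{a_{j,k}} u (x)`. -/
def pdoPartial {d : ℕ} (D : LPData d) (a : RD d → RD d → ℂ) (N : ℕ)
    (u : TD d) (x : RD d) : ℂ :=
  ∑ j ∈ Finset.range (N+1), ∑ k ∈ Finset.range (N+1), pdoPieceD D a j k u x

/-- `T_a u` converges in `S'` to the tempered distribution `Tf`: the partial sums
`Σ_{j,k≤N} T_{a_{j,k}} u` (which are functions) converge to `Tf` weakly. -/
def ConvergesInSPrime {d : ℕ} (D : LPData d) (a : RD d → RD d → ℂ)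
    (u : TD d) (Tf : TD d) : Prop :=
  ∀ ψ : 𝓢(RD d, ℂ),
    Tendsto (fun N => ∫ x, pdoPartial D a N u x * ψ x) atTop (nhds (Tf ψ))

/-- The dyadic cube of level `ν` (side length `2^{-ν}`) indexed by `n ∈ ℤ^d`. -/
def dyadicCube (d : ℕ) (ν : ℤ) (n : Fin d → ℤ) : Set (RD d) :=
  {x | ∀ i, (n i : ℝ) * (2:ℝ)^(-ν) ≤ x i ∧ x i < ((n i : ℝ) + 1) * (2:ℝ)^(-ν)}

/-- The local quantity `(|P|⁻¹ ∫_P Σ_{k=k₀}^∞ 2^{skq} ‖g_k(x)‖^q dx)^{1/q}` for the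
dyadic cube `P` of level `μ` indexed by `n` (so that `|P|⁻¹ = 2^{μd}`). -/
def cubePiece (d : ℕ) (μ : ℕ) (n : Fin d → ℤ) (k₀ : ℕ) (s q : ℝ)
    (g : ℕ → RD d → ℂ) : ℝ≥0∞ :=
  ((2:ℝ≥0∞)^((μ:ℝ)*(d:ℝ)) *
    ∫⁻ x in dyadicCube d μ n,
      ∑' j : ℕ, (2:ℝ≥0∞)^(s*((k₀:ℝ)+(j:ℝ))*q) * (‖g (k₀+j) x‖₊ : ℝ≥0∞)^q) ^ (1/q)

/-- The `F_∞^{s,q}` norm (for `q < ∞`) of a function, computed from its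
Littlewood–Paley pieces:
`‖Π_0 g‖_∞ + sup_{l(P)<1 dyadic} (|P|⁻¹ ∫_P Σ_{k=-log₂ l(P)}^∞ 2^{skq}|Π_k g|^q)^{1/q}`. -/
def FinftyNormFun {d : ℕ} (D : LPData d) (s q : ℝ) (g : RD d → ℂ) : ℝ≥0∞ :=
  (⨆ x : RD d, (‖LP D 0 g x‖₊ : ℝ≥0∞)) +
  ⨆ (μ : ℕ) (_ : 1 ≤ μ) (n : Fin d → ℤ),
    cubePiece d μ n μ s q (fun k x => LP D k g x)

/-- The `F_∞^{s,q}` norm (for `q < ∞`) of a tempered distribution. -/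
def FinftyNormDist {d : ℕ} (D : LPData d) (s q : ℝ) (u : TD d) : ℝ≥0∞ :=
  (⨆ x : RD d, (‖LPdist D 0 u x‖₊ : ℝ≥0∞)) +
  ⨆ (μ : ℕ) (_ : 1 ≤ μ) (n : Fin d → ℤ),
    cubePiece d μ n μ s q (fun k x => LPdist D k u x)

/-- The (axis-parallel, closed) cube with corner `c` and side length `L`. -/
def cube (d : ℕ) (c : RD d) (L : ℝ) : Set (RD d) :=
  {x | ∀ i, c i ≤ x i ∧ x i ≤ c i + L}

/-- The average of `g` over the cube with corner `c` and side length `L`. -/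
def cubeMean {d : ℕ} (c : RD d) (L : ℝ) (g : RD d → ℂ) : ℂ :=
  (L^d)⁻¹ • ∫ x in cube d c L, g x

/-- The `bmo` norm (local BMO):
`sup_{l(Q)≥1} |Q|⁻¹∫_Q |g| + sup_{l(Q)<1} |Q|⁻¹∫_Q |g - g_Q|`, over all cubes `Q`. -/
def bmoNorm (d : ℕ) (g : RD d → ℂ) : ℝ≥0∞ :=
  (⨆ (c : RD d) (L : ℝ) (_ : 1 ≤ L),
    ENNReal.ofReal ((L^d)⁻¹) * ∫⁻ x in cube d c L, (‖g x‖₊ : ℝ≥0∞)) +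
  (⨆ (c : RD d) (L : ℝ) (_ : 0 < L) (_ : L < 1),
    ENNReal.ofReal ((L^d)⁻¹) * ∫⁻ x in cube d c L, (‖g x - cubeMean c L g‖₊ : ℝ≥0∞))

/-- The Peetre maximal function `𝔐_{σ,R} g(x) = sup_y ‖g(x-y)‖/(1+R‖y‖)^σ`. -/
def peetre {d : ℕ} (σ R : ℝ) (g : RD d → ℂ) (x : RD d) : ℝ≥0∞ :=
  ⨆ y : RD d, (‖g (x - y)‖₊ : ℝ≥0∞) / ENNReal.ofReal ((1 + R * ‖y‖) ^ σ)

/-- `g` has (distributional) Fourier support contained in `K`: the pairing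
`⟨ĝ, ψ⟩ = ∫ g · ψ̂` vanishes for every Schwartz `ψ` whose support does not meet `K`. -/
def HasFourierSupportIn {d : ℕ} (g : RD d → ℂ) (K : Set (RD d)) : Prop :=
  ∀ ψ : 𝓢(RD d, ℂ), tsupport ⇑ψ ∩ K = ∅ → ∫ x, g x * fourierS ψ x = 0

/-- The near-diagonal part `S^{near}_a f = Σ_{|j-k| ≤ 2} T_{a_{j,k}} f`. -/
def Snear {d : ℕ} (D : LPData d) (a : RD d → RD d → ℂ) (f : 𝓢(RD d, ℂ)) (x : RD d) : ℂ :=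
  ∑' p : ℕ × ℕ,
    if |(p.1 : ℤ) - (p.2 : ℤ)| ≤ 2 then pdo (symbolPiece D a p.1 p.2) f x else 0

/-! ### Dyadic cubes -/

lemma norm_le_card_mul {d : ℕ} (v : RD d) {r : ℝ} (hr : 0 ≤ r) (h : ∀ i, |v i| ≤ r) :
    ‖v‖ ≤ d * r := by
  rw [EuclideanSpace.norm_eq]
  apply Real.sqrt_le_iff.mpr
  refine ⟨by positivity, ?_⟩
  calc ∑ i, ‖v i‖ ^ 2 ≤ ∑ _i : Fin d, r ^ 2 := by
        gcongr with i
        exact h i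
    _ = d * r ^ 2 := by simp
    _ ≤ (d * r) ^ 2 := by
        rcases Nat.eq_zero_or_pos d with rfl | hd
        · simp
        · have : (1 : ℝ) ≤ d := by exact_mod_cast hd
          nlinarith [mul_nonneg (sub_nonneg.mpr this) (mul_nonneg (sq_nonneg r) (by positivity : (0:ℝ) ≤ d))]

lemma measurableSet_cube (d : ℕ) (c : RD d) (L : ℝ) : MeasurableSet (cube d c L) := by
  have : cube d c L = ⋂ i, {x : RD d | c i ≤ x i ∧ x i ≤ c i + L} := by
    ext x; simp [cube]
  rw [this]
  refine MeasurableSet.iInter fun i => ?_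
  have hm : Measurable fun x : RD d => x i := by fun_prop
  exact (measurableSet_le measurable_const hm).inter (measurableSet_le hm measurable_const)

lemma volume_cube (d : ℕ) (c : RD d) (L : ℝ) :
    volume (cube d c L) = ENNReal.ofReal L ^ d := by
  have : cube d c L = WithLp.ofLp ⁻¹' (Set.Icc (c.ofLp) (fun i => c i + L)) := by
    ext x
    simp only [cube, Set.mem_ofPred_eq, Set.mem_preimage, Set.mem_Icc, Pi.le_def]
    exact forall_and
  rw [this, (PiLp.volume_preserving_ofLp (Fin d)).measure_preimage
    measurableSet_Icc.nullMeasurableSet, Real.volume_Icc_pi]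
  simp

lemma measurableSet_dyadicCube (d : ℕ) (ν : ℤ) (n : Fin d → ℤ) :
    MeasurableSet (dyadicCube d ν n) := by
  have : dyadicCube d ν n = ⋂ i, {x : RD d | (n i : ℝ) * (2:ℝ)^(-ν) ≤ x i ∧
      x i < ((n i : ℝ) + 1) * (2:ℝ)^(-ν)} := by
    ext x; simp [dyadicCube]
  rw [this]
  refine MeasurableSet.iInter fun i => ?_
  have hm : Measurable fun x : RD d => x i := by fun_prop
  exact (measurableSet_le measurable_const hm).inter (measurableSet_lt hm measurable_const)

lemma volume_dyadicCube (d ν : ℕ) (n : Fin d → ℤ) :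
    volume (dyadicCube d ν n) = ((2:ℝ≥0∞) ^ (ν * d))⁻¹ := by
  have : dyadicCube d ν n = WithLp.ofLp ⁻¹' (Set.univ.pi fun i =>
      Set.Ico ((n i : ℝ) * (2:ℝ)^(-(ν:ℤ))) (((n i : ℝ) + 1) * (2:ℝ)^(-(ν:ℤ)))) := by
    ext x
    simp [dyadicCube]
  rw [this, (PiLp.volume_preserving_ofLp (Fin d)).measure_preimage
    (MeasurableSet.univ_pi fun i => measurableSet_Ico).nullMeasurableSet, Real.volume_pi_Ico]
  have h : ∀ i, ENNReal.ofReal (((n i : ℝ) + 1) * (2:ℝ)^(-(ν:ℤ)) - (n i : ℝ) * (2:ℝ)^(-(ν:ℤ)))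
      = ((2:ℝ≥0∞) ^ ν)⁻¹ := by
    intro i
    rw [← sub_mul, add_sub_cancel_left, one_mul, zpow_neg, zpow_natCast,
      ENNReal.ofReal_inv_of_pos (by positivity), ENNReal.ofReal_pow (by norm_num)]
    simp
  simp only [h, Finset.prod_const, Finset.card_univ, Fintype.card_fin, pow_mul, ENNReal.inv_pow]

lemma mem_dyadicCube_iff {d : ℕ} {ν : ℤ} {n : Fin d → ℤ} {x : RD d} :
    x ∈ dyadicCube d ν n ↔ ∀ i, ⌊x i * (2:ℝ) ^ ν⌋ = n i := by
  simp only [dyadicCube, Set.mem_ofPred_eq, Int.floor_eq_iff, zpow_neg]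
  have h2 : (0:ℝ) < 2 ^ ν := by positivity
  refine forall_congr' fun i => and_congr ?_ ?_
  · rw [← div_eq_mul_inv, div_le_iff₀ h2]
  · rw [← div_eq_mul_inv, lt_div_iff₀ h2]

lemma iUnion_dyadicCube (d : ℕ) (ν : ℤ) : ⋃ n, dyadicCube d ν n = Set.univ := by
  ext x
  simp only [Set.mem_iUnion, Set.mem_univ, iff_true]
  exact ⟨fun i => ⌊x i * (2:ℝ) ^ ν⌋, mem_dyadicCube_iff.mpr fun i => rfl⟩

lemma pairwise_disjoint_dyadicCube (d : ℕ) (ν : ℤ) :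
    Pairwise (Function.onFun Disjoint (dyadicCube d ν)) := by
  intro n n' hn
  refine Set.disjoint_left.mpr fun x hx hx' => hn ?_
  funext i
  rw [← mem_dyadicCube_iff.mp hx i, ← mem_dyadicCube_iff.mp hx' i]

lemma abs_sub_le_of_mem_dyadicCube {d ν : ℕ} {n : Fin d → ℤ} {x y : RD d}
    (hx : x ∈ dyadicCube d ν n) (hy : y ∈ dyadicCube d ν n) (i : Fin d) :
    |x i - y i| ≤ ((2:ℝ) ^ ν)⁻¹ := by
  have h1 := hx i
  have h2 := hy i
  rw [zpow_neg, zpow_natCast, add_mul, one_mul] at h1 h2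
  rw [abs_le]
  constructor <;> linarith [h1.1, h1.2, h2.1, h2.2]

lemma lintegral_eq_tsum_dyadicCube (d : ℕ) (ν : ℤ) (f : RD d → ℝ≥0∞) :
    ∫⁻ x, f x = ∑' n, ∫⁻ x in dyadicCube d ν n, f x := by
  rw [← lintegral_iUnion (measurableSet_dyadicCube d ν) (pairwise_disjoint_dyadicCube d ν),
    iUnion_dyadicCube, Measure.restrict_univ]

/-- If the averages of `G` over the dyadic cubes of level `ν` are at most `A`, and `u` is dominated
by `v` across each such cube, then `∫ u G ≤ A ∫ v`. -/
lemma lintegral_mul_le_of_dyadic_average {d ν : ℕ} {G u v : RD d → ℝ≥0∞} {A : ℝ≥0∞}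
    (hG : Measurable G)
    (hA : ∀ n, (2:ℝ≥0∞) ^ (ν * d) * ∫⁻ x in dyadicCube d ν n, G x ≤ A)
    (huv : ∀ n, ∀ x ∈ dyadicCube d ν n, ∀ y ∈ dyadicCube d ν n, u x ≤ v y) :
    ∫⁻ x, u x * G x ≤ A * ∫⁻ x, v x := by
  rw [lintegral_eq_tsum_dyadicCube d ν, lintegral_eq_tsum_dyadicCube d ν, ← ENNReal.tsum_mul_left]
  refine ENNReal.tsum_le_tsum fun n => ?_
  set s := ⨆ x ∈ dyadicCube d ν n, u x with hs
  have hP := measurableSet_dyadicCube d ν n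
  calc ∫⁻ x in dyadicCube d ν n, u x * G x
      ≤ ∫⁻ x in dyadicCube d ν n, s * G x := by
        refine setLIntegral_mono' hP fun x hx => ?_
        gcongr
        exact le_iSup₂ (f := fun x _ => u x) x hx
    _ = s * ∫⁻ x in dyadicCube d ν n, G x := lintegral_const_mul _ hG
    _ ≤ s * (A * volume (dyadicCube d ν n)) := by
        gcongr
        rw [volume_dyadicCube, ← div_eq_mul_inv]
        refine (ENNReal.le_div_iff_mul_le (Or.inl (by simp)) (Or.inl (by simp))).mpr ?_
        rw [mul_comm]
        exact hA n
    _ = A * ∫⁻ _ in dyadicCube d ν n, s := by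
        rw [setLIntegral_const]; ring
    _ ≤ A * ∫⁻ x in dyadicCube d ν n, v x := by
        gcongr 1
        refine setLIntegral_mono' hP fun y hy => ?_
        exact iSup₂_le fun x hx => huv n x hx y hy

/-! ### Polynomially decaying weights -/

/-- The weight `(1 + 2^k |w|)^{-(d+1)}`. -/
def weight (d k : ℕ) (w : RD d) : ℝ≥0∞ := ENNReal.ofReal (((1 + 2 ^ k * ‖w‖) ^ (d + 1))⁻¹)

lemma measurable_weight (d k : ℕ) : Measurable (weight d k) := by
  unfold weight; fun_prop

lemma weight_neg {d k : ℕ} (w : RD d) : weight d k (-w) = weight d k w := by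
  simp [weight]

lemma weight_le_one {d k : ℕ} (w : RD d) : weight d k w ≤ 1 := by
  unfold weight
  rw [ENNReal.ofReal_le_one]
  refine inv_le_one_of_one_le₀ (one_le_pow₀ ?_)
  have : 0 ≤ 2 ^ k * ‖w‖ := by positivity
  linarith

lemma weight_anti {d k l : ℕ} (h : l ≤ k) (w : RD d) : weight d k w ≤ weight d l w := by
  unfold weight
  gcongr
  norm_num

lemma weight_le_mul {d k : ℕ} {w w' : RD d} {R : ℝ} (hR : 0 ≤ R) (h : 2 ^ k * ‖w - w'‖ ≤ R) :
    weight d k w ≤ ENNReal.ofReal ((1 + R) ^ (d + 1)) * weight d k w' := by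
  unfold weight
  rw [← ENNReal.ofReal_mul (by positivity)]
  apply ENNReal.ofReal_le_ofReal
  rw [← inv_pow, ← inv_pow, ← mul_pow]
  gcongr
  rw [← div_eq_mul_inv, inv_eq_one_div, div_le_div_iff₀ (by positivity) (by positivity)]
  have h1 : ‖w'‖ ≤ ‖w‖ + ‖w - w'‖ := by
    have := norm_sub_le w (w - w')
    simpa using this
  have h2 : 2 ^ k * ‖w'‖ ≤ 2 ^ k * ‖w‖ + 2 ^ k * ‖w - w'‖ := by
    rw [← mul_add]; gcongr
  have h3 : 0 ≤ R * (2 ^ k * ‖w‖) := by positivity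
  nlinarith

/-- The total mass of `weight d 0`. -/
def weightMass (d : ℕ) : ℝ≥0∞ := ∫⁻ w, weight d 0 w

lemma weightMass_ne_top (d : ℕ) : weightMass d ≠ ⊤ := by
  have h := finite_integral_one_add_norm (E := RD d) (μ := volume) (r := (d + 1 : ℕ))
    (by simp)
  refine ne_of_lt (lt_of_le_of_lt (lintegral_mono fun w => ?_) h)
  unfold weight
  rw [Real.rpow_neg (by positivity), Real.rpow_natCast]
  simp

lemma lintegral_comp_two_pow_smul {d k : ℕ} {g : RD d → ℝ≥0∞} (hg : Measurable g) :
    (2:ℝ≥0∞) ^ (k * d) * ∫⁻ w, g ((2:ℝ) ^ k • w) = ∫⁻ w, g w := by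
  have h2 : ((2:ℝ) ^ k) ≠ 0 := by positivity
  have h := Measure.map_addHaar_smul (volume : Measure (RD d)) h2
  have hm : ∫⁻ w, g ((2:ℝ) ^ k • w) = ∫⁻ w, g w ∂(Measure.map ((2:ℝ) ^ k • ·) volume) := by
    rw [lintegral_map hg (by fun_prop)]
  rw [hm, h, lintegral_smul_measure]
  simp only [finrank_euclideanSpace, Fintype.card_fin, smul_eq_mul]
  rw [← mul_assoc, abs_of_pos (by positivity), ENNReal.ofReal_inv_of_pos (by positivity),
    ← pow_mul, ENNReal.ofReal_pow (by norm_num)]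
  simp only [ENNReal.ofReal_ofNat]
  rw [ENNReal.mul_inv_cancel (by simp) (by simp), one_mul]

lemma lintegral_weight (d k : ℕ) :
    (2:ℝ≥0∞) ^ (k * d) * ∫⁻ w, weight d k w = weightMass d := by
  rw [weightMass, ← lintegral_comp_two_pow_smul (k := k) (measurable_weight d 0)]
  congr 2
  funext w
  simp [weight, norm_smul]

lemma lintegral_weight_sub (d k : ℕ) (c : RD d) :
    ∫⁻ w, weight d k (w - c) = ∫⁻ w, weight d k w :=
  lintegral_sub_right_eq_self (weight d k) c

/-- The average of `G` against the weight `2^{kd} (1 + 2^k |x - z|)^{-2(d+1)}`. -/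
def smoothAvg (d k : ℕ) (G : RD d → ℝ≥0∞) (x : RD d) : ℝ≥0∞ :=
  ∫⁻ z, (2:ℝ≥0∞) ^ (k * d) * weight d k (x - z) ^ 2 * G z

lemma measurable_smoothAvg {d k : ℕ} {G : RD d → ℝ≥0∞} (hG : Measurable G) :
    Measurable (smoothAvg d k G) := by
  unfold smoothAvg
  refine Measurable.lintegral_prod_right' (f := fun p : RD d × RD d =>
    (2:ℝ≥0∞) ^ (k * d) * weight d k (p.1 - p.2) ^ 2 * G p.2) ?_
  have := (measurable_weight d k).comp (measurable_fst.sub measurable_snd :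
    Measurable fun p : RD d × RD d => p.1 - p.2)
  exact ((this.pow_const 2).const_mul _).mul (hG.comp measurable_snd)

lemma two_pow_mul_norm_sub_le {d ν : ℕ} {n : Fin d → ℤ} {x y : RD d}
    (hx : x ∈ dyadicCube d ν n) (hy : y ∈ dyadicCube d ν n) :
    2 ^ ν * ‖x - y‖ ≤ d := by
  have h := norm_le_card_mul (x - y) (r := ((2:ℝ) ^ ν)⁻¹) (by positivity)
    fun i => by simpa using abs_sub_le_of_mem_dyadicCube hx hy i
  calc 2 ^ ν * ‖x - y‖ ≤ 2 ^ ν * (d * ((2:ℝ) ^ ν)⁻¹) := by gcongr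
    _ = d := by field_simp

/-- A bound depending only on the dimension. -/
def avgConst (d : ℕ) : ℝ≥0∞ := ENNReal.ofReal ((1 + (d:ℝ)) ^ (d + 1)) * weightMass d

lemma avgConst_ne_top (d : ℕ) : avgConst d ≠ ⊤ :=
  ENNReal.mul_ne_top ENNReal.ofReal_ne_top (weightMass_ne_top d)

lemma lintegral_weight_mul_le {d ν : ℕ} {G : RD d → ℝ≥0∞} {A : ℝ≥0∞} (hG : Measurable G)
    (hA : ∀ n, (2:ℝ≥0∞) ^ (ν * d) * ∫⁻ x in dyadicCube d ν n, G x ≤ A) (c : RD d) :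
    (2:ℝ≥0∞) ^ (ν * d) * ∫⁻ z, weight d ν (z - c) * G z ≤ avgConst d * A := by
  have h := lintegral_mul_le_of_dyadic_average (u := fun z => weight d ν (z - c))
    (v := fun z => ENNReal.ofReal ((1 + (d:ℝ)) ^ (d + 1)) * weight d ν (z - c)) hG hA
    fun n x hx y hy => weight_le_mul (by positivity)
      (by simpa using two_pow_mul_norm_sub_le hx hy)
  calc _ ≤ (2:ℝ≥0∞) ^ (ν * d) * (A * ∫⁻ z, ENNReal.ofReal ((1 + (d:ℝ)) ^ (d + 1)) *
        weight d ν (z - c)) := by gcongr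
    _ = ENNReal.ofReal ((1 + (d:ℝ)) ^ (d + 1)) * ((2:ℝ≥0∞) ^ (ν * d) * ∫⁻ z, weight d ν z) * A := by
        rw [lintegral_const_mul' _ _ ENNReal.ofReal_ne_top, lintegral_weight_sub]; ring
    _ = avgConst d * A := by rw [lintegral_weight, avgConst]

lemma smoothAvg_le {d k : ℕ} {G : RD d → ℝ≥0∞} {A : ℝ≥0∞} (hG : Measurable G)
    (hA : ∀ n, (2:ℝ≥0∞) ^ (k * d) * ∫⁻ x in dyadicCube d k n, G x ≤ A) (x : RD d) :
    smoothAvg d k G x ≤ avgConst d * A := by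
  refine le_trans ?_ (lintegral_weight_mul_le hG hA x)
  rw [← lintegral_const_mul' _ _ (by simp)]
  refine lintegral_mono fun z => ?_
  rw [← neg_sub, weight_neg, mul_assoc, sq, mul_assoc]
  gcongr
  exact mul_le_of_le_one_left (by positivity) (weight_le_one _)

lemma smoothAvg_le_of_le {d k : ℕ} {G : RD d → ℝ≥0∞} {A : ℝ≥0∞} (hA : ∀ x, G x ≤ A) (x : RD d) :
    smoothAvg d k G x ≤ weightMass d * A := by
  calc smoothAvg d k G x ≤ ∫⁻ z, ((2:ℝ≥0∞) ^ (k * d) * A) * weight d k (z - x) := by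
        refine lintegral_mono fun z => ?_
        rw [← neg_sub, weight_neg]
        calc (2:ℝ≥0∞) ^ (k * d) * weight d k (z - x) ^ 2 * G z
            ≤ (2:ℝ≥0∞) ^ (k * d) * (weight d k (z - x) * 1) * A := by
              rw [sq]; gcongr
              · exact weight_le_one _
              · exact hA z
          _ = _ := by ring
    _ = ((2:ℝ≥0∞) ^ (k * d) * A) * ∫⁻ z, weight d k z := by
        rw [lintegral_const_mul _ (by exact (measurable_weight d k).comp (measurable_sub_const x)),
          lintegral_weight_sub]
    _ = ((2:ℝ≥0∞) ^ (k * d) * ∫⁻ z, weight d k z) * A := by ring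
    _ = weightMass d * A := by rw [lintegral_weight]

/-- A second bound depending only on the dimension. -/
def cubeConst (d : ℕ) : ℝ≥0∞ :=
  ENNReal.ofReal ((1 + 2 * (d:ℝ)) ^ (d + 1)) * weightMass d * avgConst d

lemma cubeConst_ne_top (d : ℕ) : cubeConst d ≠ ⊤ :=
  ENNReal.mul_ne_top (ENNReal.mul_ne_top ENNReal.ofReal_ne_top (weightMass_ne_top d))
    (avgConst_ne_top d)

lemma norm_sub_corner_le {d : ℕ} {c x : RD d} {L : ℝ} (hL : 0 ≤ L) (hx : x ∈ cube d c L) :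
    ‖x - c‖ ≤ d * L := by
  refine norm_le_card_mul _ hL fun i => ?_
  have := hx i
  simp only [PiLp.sub_apply]
  rw [abs_le]; constructor <;> linarith [this.1, this.2]

lemma lintegral_cube_smoothAvg_le {d μ : ℕ} {G : ℕ → RD d → ℝ≥0∞} {A : ℝ≥0∞}
    (hG : ∀ k, Measurable (G k))
    (hA : ∀ n, (2:ℝ≥0∞) ^ (μ * d) * ∫⁻ x in dyadicCube d μ n, ∑' j, G (μ + j) x ≤ A)
    (c : RD d) {L : ℝ} (hL0 : 0 ≤ L) (hL : L ≤ 2 * ((2:ℝ) ^ μ)⁻¹) :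
    (2:ℝ≥0∞) ^ (μ * d) * ∫⁻ x in cube d c L, ∑' j, smoothAvg d (μ + j) (G (μ + j)) x
      ≤ cubeConst d * A := by
  set R := ENNReal.ofReal ((1 + 2 * (d:ℝ)) ^ (d + 1)) with hR
  have hQ := measurableSet_cube d c L
  have key : ∀ k, μ ≤ k → ∫⁻ x in cube d c L, smoothAvg d k (G k) x
      ≤ R * weightMass d * ∫⁻ z, weight d μ (z - c) * G k z := by
    intro k hk
    have hmeas : Measurable fun p : RD d × RD d => weight d k (p.1 - p.2) :=
      (measurable_weight d k).comp (measurable_fst.sub measurable_snd)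
    unfold smoothAvg
    rw [lintegral_lintegral_swap]
    swap
    · exact (((hmeas.pow_const 2).const_mul _).mul ((hG k).comp measurable_snd)).aemeasurable
    rw [← lintegral_const_mul _ (by
      exact ((measurable_weight d μ).comp (measurable_sub_const c)).mul (hG k))]
    refine lintegral_mono fun z => ?_
    calc ∫⁻ x in cube d c L, (2:ℝ≥0∞) ^ (k * d) * weight d k (x - z) ^ 2 * G k z
        ≤ ∫⁻ x in cube d c L, ((2:ℝ≥0∞) ^ (k * d) * R * weight d μ (z - c) * G k z)
            * weight d k (x - z) := by
          refine setLIntegral_mono' hQ fun x hx => ?_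
          have h1 : weight d k (x - z) ≤ R * weight d μ (z - c) := by
            refine (weight_anti hk _).trans ?_
            rw [← neg_sub, weight_neg]
            refine weight_le_mul (by positivity) ?_
            rw [sub_sub_sub_cancel_left, norm_sub_rev]
            calc 2 ^ μ * ‖x - c‖ ≤ 2 ^ μ * (d * (2 * ((2:ℝ) ^ μ)⁻¹)) := by
                  gcongr
                  exact (norm_sub_corner_le hL0 hx).trans (by gcongr)
              _ = 2 * d := by field_simp
          calc (2:ℝ≥0∞) ^ (k * d) * weight d k (x - z) ^ 2 * G k z
              = (2:ℝ≥0∞) ^ (k * d) * weight d k (x - z) * G k z * weight d k (x - z) := by ring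
            _ ≤ (2:ℝ≥0∞) ^ (k * d) * (R * weight d μ (z - c)) * G k z * weight d k (x - z) := by
                gcongr
            _ = _ := by ring
      _ ≤ ∫⁻ x, ((2:ℝ≥0∞) ^ (k * d) * R * weight d μ (z - c) * G k z) * weight d k (x - z) :=
          setLIntegral_le_lintegral _ _
      _ = ((2:ℝ≥0∞) ^ (k * d) * R * weight d μ (z - c) * G k z) * ∫⁻ x, weight d k x := by
          rw [lintegral_const_mul _ (by exact (measurable_weight d k).comp (measurable_sub_const z)),
            lintegral_weight_sub]
      _ = R * ((2:ℝ≥0∞) ^ (k * d) * ∫⁻ x, weight d k x) * (weight d μ (z - c) * G k z) := by ring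
      _ = _ := by rw [lintegral_weight]
  rw [lintegral_tsum fun j => (measurable_smoothAvg (hG _)).aemeasurable]
  calc (2:ℝ≥0∞) ^ (μ * d) * ∑' j, ∫⁻ x in cube d c L, smoothAvg d (μ + j) (G (μ + j)) x
      ≤ (2:ℝ≥0∞) ^ (μ * d) *
          ∑' j, R * weightMass d * ∫⁻ z, weight d μ (z - c) * G (μ + j) z := by
        gcongr with j
        exact key _ (by omega)
    _ = R * weightMass d * ((2:ℝ≥0∞) ^ (μ * d) *
          ∫⁻ z, weight d μ (z - c) * ∑' j, G (μ + j) z) := by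
        rw [ENNReal.tsum_mul_left, ← lintegral_tsum fun j => by
          exact (((measurable_weight d μ).comp (measurable_sub_const c)).mul (hG _)).aemeasurable]
        simp only [ENNReal.tsum_mul_left]
        ring
    _ ≤ R * weightMass d * (avgConst d * A) := by
        gcongr 1
        exact lintegral_weight_mul_le (Measurable.tsum fun j => hG _) hA c
    _ = cubeConst d * A := by rw [cubeConst]; ring

/-! ### An abstract criterion for a bound on the local BMO norm -/

lemma tsum_near_diagonal_le (w : ℕ → ℝ≥0∞) :
    ∑' p : ℕ × ℕ, (if |(p.1 : ℤ) - (p.2 : ℤ)| ≤ 2 then w p.2 else 0) ≤ 5 * ∑' k, w k := by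
  rw [ENNReal.tsum_prod', ENNReal.tsum_comm, ← ENNReal.tsum_mul_left]
  refine ENNReal.tsum_le_tsum fun k => ?_
  rw [tsum_eq_sum (s := Finset.Icc (k - 2) (k + 2))]
  · calc ∑ j ∈ Finset.Icc (k - 2) (k + 2), (if |(j : ℤ) - (k : ℤ)| ≤ 2 then w k else 0)
        ≤ ∑ _j ∈ Finset.Icc (k - 2) (k + 2), w k := by
          gcongr with j
          split_ifs <;> simp
      _ ≤ 5 * w k := by
          rw [Finset.sum_const, nsmul_eq_mul]
          gcongr
          rw [Nat.card_Icc]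
          exact_mod_cast (by omega : k + 2 + 1 - (k - 2) ≤ 5)
  · intro j hj
    rw [if_neg]
    intro h
    rw [abs_le] at h
    exact hj (Finset.mem_Icc.mpr ⟨by omega, by omega⟩)

lemma sum_two_pow_le (μ : ℕ) : ∑ k ∈ Finset.range μ, (2:ℝ≥0∞) ^ k ≤ 2 ^ μ := by
  suffices h : ∑ k ∈ Finset.range μ, (2:ℝ≥0∞) ^ k + 1 = 2 ^ μ from h ▸ le_self_add
  induction μ with
  | zero => simp
  | succ n ih => rw [Finset.sum_range_succ, add_right_comm, ih, pow_succ]; ring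

lemma ofReal_inv_mul_volume_cube {d : ℕ} (c : RD d) {L : ℝ} (hL : 0 < L) :
    ENNReal.ofReal ((L ^ d)⁻¹) * volume (cube d c L) = 1 := by
  rw [volume_cube, ← ENNReal.ofReal_pow hL.le, ← ENNReal.ofReal_mul (by positivity),
    inv_mul_cancel₀ (by positivity), ENNReal.ofReal_one]

lemma lintegral_sub_cubeMean_le {d : ℕ} (c : RD d) {L : ℝ} (hL : 0 < L) {g : RD d → ℂ} (z : ℂ)
    (hg : AEStronglyMeasurable g (volume.restrict (cube d c L)))
    (hfin : ∫⁻ x in cube d c L, ‖g x - z‖ₑ ≠ ⊤) :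
    ENNReal.ofReal ((L ^ d)⁻¹) * ∫⁻ x in cube d c L, ‖g x - cubeMean c L g‖ₑ
      ≤ 2 * (ENNReal.ofReal ((L ^ d)⁻¹) * ∫⁻ x in cube d c L, ‖g x - z‖ₑ) := by
  set Q := cube d c L with hQ
  set I := ENNReal.ofReal ((L ^ d)⁻¹) * ∫⁻ x in Q, ‖g x - z‖ₑ with hI
  have hvol : volume Q ≠ ⊤ := by rw [hQ, volume_cube]; simp
  have hvolR : volume.real Q = L ^ d := by
    rw [Measure.real, hQ, volume_cube, ENNReal.toReal_pow, ENNReal.toReal_ofReal hL.le]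
  have hInt : IntegrableOn (fun x => g x - z) Q :=
    ⟨hg.sub aestronglyMeasurable_const, lt_top_iff_ne_top.mpr hfin⟩
  have hconst : IntegrableOn (fun _ : RD d => z) Q := integrableOn_const hvol
  have hgint : IntegrableOn g Q := by
    have := hInt.add hconst
    simpa [Pi.add_def] using this
  have hmean : z - cubeMean c L g = -((L ^ d)⁻¹ • ∫ x in Q, (g x - z)) := by
    rw [integral_sub hgint hconst, setIntegral_const, hvolR, smul_sub, smul_smul,
      inv_mul_cancel₀ (by positivity), one_smul, cubeMean, neg_sub]
  have hmean_le : ‖z - cubeMean c L g‖ₑ ≤ I := by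
    rw [hmean, enorm_neg, enorm_smul, Real.enorm_eq_ofReal (by positivity), hI]
    gcongr
    exact enorm_integral_le_lintegral_enorm _
  calc ENNReal.ofReal ((L ^ d)⁻¹) * ∫⁻ x in Q, ‖g x - cubeMean c L g‖ₑ
      ≤ ENNReal.ofReal ((L ^ d)⁻¹) * ∫⁻ x in Q, (‖g x - z‖ₑ + ‖z - cubeMean c L g‖ₑ) := by
        gcongr with x
        have : g x - cubeMean c L g = (g x - z) + (z - cubeMean c L g) := by ring
        rw [this]
        exact enorm_add_le _ _
    _ = I + ENNReal.ofReal ((L ^ d)⁻¹) * volume Q * ‖z - cubeMean c L g‖ₑ := by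
        rw [lintegral_add_right _ measurable_const, setLIntegral_const, mul_add]
        ring
    _ ≤ I + I := by
        rw [ofReal_inv_mul_volume_cube c hL, one_mul]; gcongr
    _ = 2 * I := (two_mul _).symm

lemma dyadicCube_subset_cube (d ν : ℕ) (n : Fin d → ℤ) :
    dyadicCube d ν n ⊆ cube d (WithLp.toLp 2 fun i => (n i : ℝ) * ((2:ℝ) ^ ν)⁻¹) ((2:ℝ) ^ ν)⁻¹ := by
  intro x hx i
  have := hx i
  rw [zpow_neg, zpow_natCast, add_mul, one_mul] at this
  exact ⟨this.1, this.2.le⟩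

lemma lintegral_cube_le_of_dyadic_average {d : ℕ} {H : RD d → ℝ≥0∞} {A : ℝ≥0∞} (hH : Measurable H)
    (hA : ∀ n, (2:ℝ≥0∞) ^ (1 * d) * ∫⁻ x in dyadicCube d (1 : ℕ) n, H x ≤ A)
    (c : RD d) {L : ℝ} (hL : 1 ≤ L) :
    ENNReal.ofReal ((L ^ d)⁻¹) * ∫⁻ x in cube d c L, H x ≤ 3 ^ d * A := by
  set c' : RD d := WithLp.toLp 2 fun i => c i - 1 with hc'
  have h := lintegral_mul_le_of_dyadic_average (u := (cube d c L).indicator 1)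
    (v := (cube d c' (L + 2)).indicator 1) hH hA ?_
  · have h1 : ∫⁻ x, (cube d c L).indicator 1 x * H x = ∫⁻ x in cube d c L, H x := by
      rw [← lintegral_indicator (measurableSet_cube d c L)]
      refine lintegral_congr fun x => ?_
      by_cases hx : x ∈ cube d c L <;> simp [hx]
    rw [h1, lintegral_indicator_one (measurableSet_cube d c' (L + 2)), volume_cube] at h
    calc ENNReal.ofReal ((L ^ d)⁻¹) * ∫⁻ x in cube d c L, H x
        ≤ ENNReal.ofReal ((L ^ d)⁻¹) * (A * ENNReal.ofReal (3 * L) ^ d) := by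
          gcongr
          refine h.trans ?_
          gcongr
          linarith
      _ = ENNReal.ofReal ((L ^ d)⁻¹) * ENNReal.ofReal L ^ d * (3 ^ d * A) := by
          rw [ENNReal.ofReal_mul (by norm_num), mul_pow, ENNReal.ofReal_ofNat]; ring
      _ = 3 ^ d * A := by
          rw [← volume_cube d c L, ofReal_inv_mul_volume_cube c (by linarith), one_mul]
  · intro n x hx y hy
    by_cases hxQ : x ∈ cube d c L
    · have hyQ : y ∈ cube d c' (L + 2) := by
        intro i
        have h1 := abs_le.mp (abs_sub_le_of_mem_dyadicCube hx hy i)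
        have h2 := hxQ i
        norm_num at h1
        simp only [hc']
        constructor <;> linarith [h1.1, h1.2, h2.1, h2.2]
      simp [hxQ, hyQ]
    · simp [hxQ]

/-- A near-diagonal double series whose terms are controlled at their own scale, both in size
(through `B`) and in Lipschitz norm, is in local BMO. -/
lemma bmoNorm_tsum_le {d : ℕ} {G : ℕ × ℕ → RD d → ℂ} {B : ℕ → RD d → ℝ≥0∞} {A : ℝ≥0∞}
    (hA : A ≠ ⊤) (hB : ∀ k, Measurable (B k))
    (hnear : ∀ p x, ¬ |(p.1 : ℤ) - (p.2 : ℤ)| ≤ 2 → G p x = 0)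
    (hGB : ∀ p x, ‖G p x‖ₑ ≤ B p.2 x) (hB0 : ∀ x, B 0 x ≤ A)
    (hLip : ∀ p x y, ‖G p x - G p y‖ₑ ≤ A * 2 ^ p.2 * ‖x - y‖ₑ)
    (hhigh : ∀ μ, 1 ≤ μ → ∀ (c : RD d) (L : ℝ), 0 ≤ L → L ≤ 2 * ((2:ℝ) ^ μ)⁻¹ →
      (2:ℝ≥0∞) ^ (μ * d) * ∫⁻ x in cube d c L, ∑' j, B (μ + j) x ≤ A) :
    bmoNorm d (fun x => ∑' p, G p x) ≤ (5 * (1 + 3 ^ d) + 2 * (5 * (2 * d + 1))) * A := by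
  rw [add_mul]
  refine add_le_add ?_ ?_
  · refine iSup_le fun c => iSup_le fun L => iSup_le fun hL => ?_
    have hL0 : 0 < L := by linarith
    have hpt : ∀ x, ‖∑' p, G p x‖ₑ ≤ 5 * (A + ∑' j, B (1 + j) x) := by
      intro x
      calc ‖∑' p, G p x‖ₑ ≤ ∑' p, ‖G p x‖ₑ := enorm_tsum_le_tsum_enorm
        _ ≤ ∑' p : ℕ × ℕ, (if |(p.1 : ℤ) - (p.2 : ℤ)| ≤ 2 then B p.2 x else 0) := by
            refine ENNReal.tsum_le_tsum fun p => ?_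
            split_ifs with h
            · exact hGB p x
            · simp [hnear p x h]
        _ ≤ 5 * ∑' k, B k x := tsum_near_diagonal_le _
        _ ≤ _ := by
            rw [tsum_eq_zero_add' ENNReal.summable]
            simp only [add_comm 1]
            gcongr
            exact hB0 x
    have hT : Measurable fun x => ∑' j, B (1 + j) x := Measurable.tsum fun j => hB _
    calc ENNReal.ofReal ((L ^ d)⁻¹) * ∫⁻ x in cube d c L, ‖∑' p, G p x‖ₑ
        ≤ ENNReal.ofReal ((L ^ d)⁻¹) * ∫⁻ x in cube d c L, 5 * (A + ∑' j, B (1 + j) x) := by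
          gcongr with x
          exact hpt x
      _ = 5 * (ENNReal.ofReal ((L ^ d)⁻¹) * volume (cube d c L) * A +
            ENNReal.ofReal ((L ^ d)⁻¹) * ∫⁻ x in cube d c L, ∑' j, B (1 + j) x) := by
          rw [lintegral_const_mul _ (hT.const_add _), lintegral_add_left measurable_const,
            setLIntegral_const]
          ring
      _ ≤ 5 * (A + 3 ^ d * A) := by
          rw [ofReal_inv_mul_volume_cube c hL0, one_mul]
          gcongr 5 * (A + ?_)
          refine lintegral_cube_le_of_dyadic_average hT (fun n => ?_) c hL
          refine le_trans ?_ (hhigh 1 le_rfl (WithLp.toLp 2 fun i => (n i : ℝ) * ((2:ℝ) ^ 1)⁻¹)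
            (((2:ℝ) ^ 1)⁻¹) (by positivity) (by norm_num))
          gcongr
          exact dyadicCube_subset_cube d 1 n
      _ = _ := by ring
  · refine iSup_le fun c => iSup_le fun L => iSup_le fun hL0 => iSup_le fun hL1 => ?_
    obtain ⟨n, hn1, hn2⟩ := exists_nat_pow_near_of_lt_one hL0 hL1.le
      (by norm_num : (0:ℝ) < 2⁻¹) (by norm_num)
    set μ := n + 1 with hμ
    have hLμ : L ≤ 2 * ((2:ℝ) ^ μ)⁻¹ := by
      rw [← inv_pow, hμ, pow_succ]; linarith
    have hLd : ENNReal.ofReal ((L ^ d)⁻¹) ≤ 2 ^ (μ * d) := by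
      have : (L ^ d)⁻¹ ≤ 2 ^ (μ * d) := by
        rw [pow_mul, ← inv_pow]
        gcongr
        rw [inv_le_comm₀ hL0 (by positivity), ← inv_pow]
        exact hn1.le
      refine (ENNReal.ofReal_le_ofReal this).trans ?_
      rw [ENNReal.ofReal_pow (by norm_num), ENNReal.ofReal_ofNat]
    set T : RD d → ℝ≥0∞ := fun x => ∑' j, B (μ + j) x with hTdef
    have hT : Measurable T := Measurable.tsum fun j => hB _
    have hTint := hhigh μ (by omega) c L hL0.le hLμ
    have hTfin : ∫⁻ x in cube d c L, T x ≠ ⊤ := by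
      intro h
      rw [h, ENNReal.mul_top (by simp)] at hTint
      exact hA (top_le_iff.mp hTint)
    set S : Finset (ℕ × ℕ) := Finset.range (μ + 2) ×ˢ Finset.range μ with hS
    have hmemS : ∀ p : ℕ × ℕ, |(p.1 : ℤ) - (p.2 : ℤ)| ≤ 2 → (p ∈ S ↔ p.2 < μ) := by
      intro p hp
      rw [abs_le] at hp
      simp only [hS, Finset.mem_product, Finset.mem_range]
      omega
    have hsplit : ∀ w : ℕ → ℝ≥0∞, ∑' k, w k = ∑ k ∈ Finset.range μ, w k + ∑' j, w (μ + j) := by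
      intro w
      rw [← Summable.sum_add_tsum_nat_add' (k := μ) ENNReal.summable]
      simp only [add_comm μ]
    have hcont : ∀ p, Continuous (G p) := by
      intro p
      have : LipschitzWith (A * 2 ^ p.2).toNNReal (G p) := by
        intro x y
        rw [ENNReal.coe_toNNReal (ENNReal.mul_ne_top hA (by simp)), edist_eq_enorm_sub,
          edist_eq_enorm_sub]
        exact hLip p x y
      exact this.continuous
    have hpt : ∀ x ∈ cube d c L, T x ≠ ⊤ → Summable (fun p => G p x) ∧
        ‖(∑' p, G p x) - ∑ p ∈ S, G p c‖ₑ ≤ 5 * (2 * d * A + T x) := by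
      intro x hx hTx
      have h2 : (2:ℝ≥0∞) ^ μ * ‖x - c‖ₑ ≤ 2 * d := by
        rw [← ofReal_norm, show (2:ℝ≥0∞) ^ μ = ENNReal.ofReal (2 ^ μ) by
          rw [ENNReal.ofReal_pow (by norm_num), ENNReal.ofReal_ofNat],
          ← ENNReal.ofReal_mul (by positivity)]
        refine (ENNReal.ofReal_le_ofReal (q := 2 * d) ?_).trans ?_
        · calc 2 ^ μ * ‖x - c‖ ≤ 2 ^ μ * (d * (2 * ((2:ℝ) ^ μ)⁻¹)) := by
                gcongr
                exact (norm_sub_corner_le hL0.le hx).trans (by gcongr)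
            _ = 2 * d := by field_simp
        · rw [ENNReal.ofReal_mul (by norm_num)]; simp
      have hle : ∑' p, ‖G p x - (if p ∈ S then G p c else 0)‖ₑ ≤ 5 * (2 * d * A + T x) := by
        calc ∑' p, ‖G p x - (if p ∈ S then G p c else 0)‖ₑ
            ≤ ∑' p : ℕ × ℕ, (if |(p.1 : ℤ) - (p.2 : ℤ)| ≤ 2 then
                (fun k => if k < μ then A * 2 ^ k * ‖x - c‖ₑ else B k x) p.2 else 0) := by
              refine ENNReal.tsum_le_tsum fun p => ?_
              by_cases hp : |(p.1 : ℤ) - (p.2 : ℤ)| ≤ 2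
              · rw [if_pos hp]
                by_cases hpμ : p.2 < μ
                · simpa [(hmemS p hp).mpr hpμ, hpμ] using hLip p x c
                · simpa [(hmemS p hp).not.mpr hpμ, hpμ] using hGB p x
              · simp [hnear p _ hp]
          _ ≤ 5 * ∑' k, (if k < μ then A * 2 ^ k * ‖x - c‖ₑ else B k x) :=
              tsum_near_diagonal_le _
          _ ≤ 5 * (2 * d * A + T x) := by
              rw [hsplit]
              gcongr
              · calc ∑ k ∈ Finset.range μ, (if k < μ then A * 2 ^ k * ‖x - c‖ₑ else B k x)
                    = A * ‖x - c‖ₑ * ∑ k ∈ Finset.range μ, 2 ^ k := by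
                      rw [Finset.mul_sum]
                      refine Finset.sum_congr rfl fun k hk => ?_
                      rw [if_pos (Finset.mem_range.mp hk)]; ring
                  _ ≤ A * ‖x - c‖ₑ * 2 ^ μ := by gcongr; exact sum_two_pow_le μ
                  _ = 2 ^ μ * ‖x - c‖ₑ * A := by ring
                  _ ≤ 2 * d * A := by gcongr
              · rw [hTdef]
                simp
      have hsS : HasSum (fun p => if p ∈ S then G p c else 0) (∑ p ∈ S, G p c) := by
        have := hasSum_sum_of_ne_finset_zero (L := .unconditional _)
          (f := fun p => if p ∈ S then G p c else 0) (s := S)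
          (fun p hp => if_neg hp)
        rwa [Finset.sum_congr rfl fun p hp => if_pos hp] at this
      have hsum : Summable fun p => G p x - (if p ∈ S then G p c else 0) := by
        refine Summable.of_enorm (ne_of_lt (lt_of_le_of_lt hle ?_))
        refine lt_top_iff_ne_top.mpr (ENNReal.mul_ne_top (by simp) (ENNReal.add_ne_top.mpr
          ⟨ENNReal.mul_ne_top (by simp [ENNReal.mul_ne_top]) hA, hTx⟩))
      have hG : Summable fun p => G p x := by
        simpa using hsum.add hsS.summable
      refine ⟨hG, ?_⟩
      rw [← hsS.tsum_eq, ← hG.tsum_sub hsS.summable]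
      exact enorm_tsum_le_tsum_enorm.trans hle
    have hQ := measurableSet_cube d c L
    have hae : ∀ᵐ x ∂volume.restrict (cube d c L), x ∈ cube d c L ∧ T x ≠ ⊤ := by
      filter_upwards [ae_restrict_mem hQ, ae_lt_top hT hTfin] with x h1 h2
      exact ⟨h1, h2.ne⟩
    have hmeas : AEStronglyMeasurable (fun x => ∑' p, G p x) (volume.restrict (cube d c L)) := by
      refine aestronglyMeasurable_of_tendsto_ae (u := atTop)
        (f := fun (s : Finset (ℕ × ℕ)) x => ∑ p ∈ s, G p x) (fun s => ?_) ?_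
      · exact (continuous_finsetSum s fun p _ => hcont p).aestronglyMeasurable
      · filter_upwards [hae] with x hx
        exact (hpt x hx.1 hx.2).1.hasSum
    have hosc : ENNReal.ofReal ((L ^ d)⁻¹) * ∫⁻ x in cube d c L,
        ‖(∑' p, G p x) - ∑ p ∈ S, G p c‖ₑ ≤ 5 * (2 * d + 1) * A := by
      calc ENNReal.ofReal ((L ^ d)⁻¹) * ∫⁻ x in cube d c L, ‖(∑' p, G p x) - ∑ p ∈ S, G p c‖ₑ
          ≤ ENNReal.ofReal ((L ^ d)⁻¹) * ∫⁻ x in cube d c L, 5 * (2 * d * A + T x) := by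
            gcongr 1
            refine lintegral_mono_ae ?_
            filter_upwards [hae] with x hx
            exact (hpt x hx.1 hx.2).2
        _ = 5 * (ENNReal.ofReal ((L ^ d)⁻¹) * volume (cube d c L) * (2 * d * A) +
              ENNReal.ofReal ((L ^ d)⁻¹) * ∫⁻ x in cube d c L, T x) := by
            rw [lintegral_const_mul _ (hT.const_add _), lintegral_add_left measurable_const,
              setLIntegral_const]
            ring
        _ ≤ 5 * (2 * d * A + A) := by
            rw [ofReal_inv_mul_volume_cube c hL0, one_mul]
            gcongr 5 * (_ + ?_)
            exact le_trans (by gcongr) hTint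
        _ = _ := by ring
    refine (lintegral_sub_cubeMean_le c hL0 (∑ p ∈ S, G p c) hmeas ?_).trans ?_
    · intro h
      rw [h, ENNReal.mul_top (by simpa using by positivity)] at hosc
      exact ENNReal.mul_ne_top (by finiteness) hA (top_le_iff.mp hosc)
    · rw [mul_assoc 2]
      gcongr

/-- The Fourier transform of a dilated function. -/
theorem fourier_comp_smul {d : ℕ} (g : RD d → ℂ) {R : ℝ} (hR : 0 < R) (w : RD d) :
    FourierTransform.fourier (fun x => g (R • x)) w =
      (R ^ d)⁻¹ • FourierTransform.fourier g (R⁻¹ • w) := by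
  have h := Measure.integral_comp_smul volume
    (fun v : RD d => Real.fourierChar (-⟪v, R⁻¹ • w⟫) • g v) R
  rw [finrank_euclideanSpace_fin, abs_of_nonneg (by positivity)] at h
  rw [Real.fourier_eq, Real.fourier_eq, ← h]
  congr 1
  ext v
  rw [real_inner_smul_left, real_inner_smul_right, mul_inv_cancel_left₀ hR.ne']

/-- Fourier decay of a smooth function supported in the ball of radius `4`. -/
theorem norm_fourier_le_of_norm_iteratedFDeriv_le {d : ℕ} (N : ℕ) {H : RD d → ℂ}
    (hH : ContDiff ℝ ∞ H) (hsupp : Function.support H ⊆ Metric.closedBall 0 4) {B : ℝ}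
    (hB : ∀ p ≤ N, ∀ ξ, ‖iteratedFDeriv ℝ p H ξ‖ ≤ B) (w : RD d) :
    ‖FourierTransform.fourier H w‖ ≤
      (2 ^ N * (1 + 2 ^ N * (N + 1)) * volume.real (Metric.closedBall (0 : RD d) 4)) * B *
        ((1 + ‖w‖) ^ N)⁻¹ := by
  set V := volume.real (Metric.closedBall (0 : RD d) 4) with hV
  have hB0 : 0 ≤ B := (norm_nonneg _).trans (hB 0 (Nat.zero_le _) 0)
  have hV0 : 0 ≤ V := measureReal_nonneg
  have hcs : HasCompactSupport H :=
    HasCompactSupport.intro (isCompact_closedBall 0 4) fun x hx => by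
      by_contra h
      exact hx (hsupp h)
  have htsupp : tsupport H ⊆ Metric.closedBall 0 4 :=
    closure_minimal hsupp Metric.isClosed_closedBall
  have hzero : ∀ n, ∀ x ∉ Metric.closedBall (0 : RD d) 4, iteratedFDeriv ℝ n H x = 0 := by
    intro n x hx
    by_contra h
    exact hx (htsupp (support_iteratedFDeriv_subset n h))
  have hcont : ∀ n : ℕ, Continuous (iteratedFDeriv ℝ n H) := fun n =>
    hH.continuous_iteratedFDeriv (mod_cast le_top)
  have hInt : ∀ (k n : ℕ), (k : ℕ∞) ≤ ⊤ → (n : ℕ∞) ≤ ⊤ →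
      Integrable (fun v : RD d => ‖v‖ ^ k * ‖iteratedFDeriv ℝ n H v‖) := by
    intro k n _ _
    refine Continuous.integrable_of_hasCompactSupport
      ((continuous_norm.pow k).mul (hcont n).norm) ?_
    exact ((hcs.iteratedFDeriv (𝕜 := ℝ) n).norm).mul_left
  have hintle : ∀ n ≤ N, ∫ v : RD d, ‖v‖ ^ 0 * ‖iteratedFDeriv ℝ n H v‖ ≤ V * B := by
    intro n hn
    have h1 : ∫ v : RD d, ‖v‖ ^ 0 * ‖iteratedFDeriv ℝ n H v‖
        = ∫ v in Metric.closedBall (0 : RD d) 4, ‖v‖ ^ 0 * ‖iteratedFDeriv ℝ n H v‖ := by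
      refine (setIntegral_eq_integral_of_forall_compl_eq_zero fun x hx => ?_).symm
      rw [hzero n x hx, norm_zero, mul_zero]
    rw [h1]
    calc _ ≤ ∫ v in Metric.closedBall (0 : RD d) 4, B := by
          refine setIntegral_mono_on (hInt 0 n le_top le_top).integrableOn ?_
            measurableSet_closedBall fun v _ => ?_
          · exact integrableOn_const (measure_closedBall_lt_top.ne)
          · simpa using hB n hn v
      _ = V * B := by rw [setIntegral_const, smul_eq_mul]
  have key : ∀ n ≤ N, ‖w‖ ^ n * ‖FourierTransform.fourier H w‖ ≤ 2 ^ n * ((n + 1) * (V * B)) := by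
    intro n hn
    have h := Real.pow_mul_norm_iteratedFDeriv_fourier_le (K := ⊤) (N := ⊤) hH hInt
      (k := 0) (n := n) le_top le_top w
    rw [norm_iteratedFDeriv_zero] at h
    refine h.trans ?_
    have hs : ∑ p ∈ Finset.range (0 + 1) ×ˢ Finset.range (n + 1),
        ∫ v : RD d, ‖v‖ ^ p.1 * ‖iteratedFDeriv ℝ p.2 H v‖ ≤ (n + 1) * (V * B) := by
      calc _ ≤ ∑ p ∈ Finset.range (0 + 1) ×ˢ Finset.range (n + 1), V * B := by
            refine Finset.sum_le_sum fun p hp => ?_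
            simp only [Finset.mem_product, Finset.mem_range] at hp
            have h0 : p.1 = 0 := by omega
            rw [h0]
            exact hintle p.2 (by omega)
        _ = _ := by simp
    calc _ = 2 ^ n * ∑ p ∈ Finset.range (0 + 1) ×ˢ Finset.range (n + 1),
        ∫ v : RD d, ‖v‖ ^ p.1 * ‖iteratedFDeriv ℝ p.2 H v‖ := by simp
      _ ≤ _ := by gcongr
  have h0 := key 0 (Nat.zero_le _)
  have hN := key N le_rfl
  have hadd : (1 + ‖w‖) ^ N ≤ 2 ^ N * (1 + ‖w‖ ^ N) := by
    have := add_pow_le (zero_le_one' ℝ) (norm_nonneg w) N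
    rw [one_pow] at this
    refine this.trans ?_
    gcongr
    · norm_num
    · omega
  rw [← div_eq_mul_inv, le_div_iff₀ (by positivity)]
  calc ‖FourierTransform.fourier H w‖ * (1 + ‖w‖) ^ N
      ≤ ‖FourierTransform.fourier H w‖ * (2 ^ N * (1 + ‖w‖ ^ N)) := by gcongr
    _ = 2 ^ N * (‖w‖ ^ 0 * ‖FourierTransform.fourier H w‖
          + ‖w‖ ^ N * ‖FourierTransform.fourier H w‖) := by ring
    _ ≤ 2 ^ N * (2 ^ 0 * (((0 : ℕ) + 1) * (V * B)) + 2 ^ N * ((N + 1) * (V * B))) := by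
        gcongr
    _ = _ := by push_cast; ring

/-- A Fourier multiplier with a decaying rescaled kernel is controlled by `smoothAvg`. -/
theorem enorm_integral_multiplier_le_smoothAvg {d : ℕ} (k : ℕ) {H u : RD d → ℂ} {B : ℝ}
    (hH : Integrable H) (hu : Integrable u)
    (hB : ∀ w, ‖FourierTransform.fourier H w‖ ≤ B * ((1 + ‖w‖) ^ (2 * (d + 1)))⁻¹) (x : RD d) :
    ‖∫ ξ, H (((2 : ℝ) ^ k)⁻¹ • ξ) * FourierTransform.fourier u ξ *
        Complex.exp (2 * Real.pi * Complex.I * ((⟪x, ξ⟫ : ℝ) : ℂ))‖ₑ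
      ≤ ENNReal.ofReal B * smoothAvg d k (fun z => ‖u z‖ₑ) x := by
  have hB0 : 0 ≤ B := by
    have := (norm_nonneg _).trans (hB 0)
    simpa using this
  have hR : (0 : ℝ) < ((2 : ℝ) ^ k)⁻¹ := by positivity
  set h : RD d → ℂ := fun ξ => H (((2 : ℝ) ^ k)⁻¹ • ξ) *
    Complex.exp (2 * Real.pi * Complex.I * ((⟪x, ξ⟫ : ℝ) : ℂ)) with hh
  have hHs : Integrable (fun ξ : RD d => H (((2 : ℝ) ^ k)⁻¹ • ξ)) := hH.comp_smul hR.ne'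
  have hhint : Integrable h := by
    refine hHs.mul_bdd (c := 1) (by fun_prop) (ae_of_all _ fun ξ => ?_)
    rw [show (2 * Real.pi * Complex.I * ((⟪x, ξ⟫ : ℝ) : ℂ))
      = ((2 * Real.pi * ⟪x, ξ⟫ : ℝ) : ℂ) * Complex.I by push_cast; ring, norm_exp_ofReal_mul_I]
  have hfour : ∀ z, FourierTransform.fourier h z =
      ((2 : ℝ) ^ (k * d)) • FourierTransform.fourier H ((2 : ℝ) ^ k • (z - x)) := by
    intro z
    have h1 : FourierTransform.fourier h z
        = FourierTransform.fourier (fun ξ : RD d => H (((2 : ℝ) ^ k)⁻¹ • ξ)) (z - x) := by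
      rw [Real.fourier_eq, Real.fourier_eq]
      congr 1
      ext ξ
      rw [Circle.smul_def, Circle.smul_def, Real.fourierChar_apply, Real.fourierChar_apply, hh]
      simp only [smul_eq_mul]
      rw [mul_left_comm, ← Complex.exp_add, mul_comm]
      congr 2
      rw [inner_sub_right, real_inner_comm ξ x]
      push_cast
      ring
    rw [h1, fourier_comp_smul H hR, inv_inv, inv_pow, inv_inv, ← pow_mul]
  have hflip : ∫ ξ, h ξ * FourierTransform.fourier u ξ
      = ∫ z, FourierTransform.fourier h z * u z := by
    have := VectorFourier.integral_bilin_fourierIntegral_eq_flip (.mul ℂ ℂ) (L := innerₗ (RD d))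
      Real.continuous_fourierChar continuous_inner hhint hu
    simpa using! this.symm
  have hcongr : ∫ ξ, H (((2 : ℝ) ^ k)⁻¹ • ξ) * FourierTransform.fourier u ξ *
        Complex.exp (2 * Real.pi * Complex.I * ((⟪x, ξ⟫ : ℝ) : ℂ))
      = ∫ ξ, h ξ * FourierTransform.fourier u ξ := by
    congr 1
    ext ξ
    simp only [hh]
    ring
  rw [hcongr, hflip]
  refine (enorm_integral_le_lintegral_enorm _).trans ?_
  rw [smoothAvg, ← lintegral_const_mul' _ _ ENNReal.ofReal_ne_top]
  refine lintegral_mono fun z => ?_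
  simp only
  rw [enorm_mul, hfour, ← mul_assoc]
  gcongr
  rw [← ofReal_norm, norm_smul]
  have hw : weight d k (x - z) ^ 2
      = ENNReal.ofReal (((1 + 2 ^ k * ‖x - z‖) ^ (2 * (d + 1)))⁻¹) := by
    rw [weight, ← ENNReal.ofReal_pow (by positivity), inv_pow, ← pow_mul, mul_comm (d + 1)]
  have h2 : (2 : ℝ≥0∞) ^ (k * d) = ENNReal.ofReal ((2 : ℝ) ^ (k * d)) := by
    rw [ENNReal.ofReal_pow zero_le_two, ENNReal.ofReal_ofNat]
  rw [hw, h2, ← ENNReal.ofReal_mul (by positivity), ← ENNReal.ofReal_mul hB0]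
  apply ENNReal.ofReal_le_ofReal
  have h3 := hB ((2 : ℝ) ^ k • (z - x))
  rw [norm_smul, Real.norm_of_nonneg (by positivity : (0 : ℝ) ≤ 2 ^ k), norm_sub_rev] at h3
  rw [Real.norm_of_nonneg (by positivity)]
  calc _ ≤ (2 : ℝ) ^ (k * d) * (B * ((1 + 2 ^ k * ‖x - z‖) ^ (2 * (d + 1)))⁻¹) := by gcongr
    _ = _ := by ring

/-- The Schwartz function whose dilate is the `k`-th Littlewood–Paley kernel. -/
def LPmother {d : ℕ} (D : LPData d) (k : ℕ) : 𝓢(RD d, ℂ) := if k = 0 then D.Φ else D.φ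

theorem LPkernel_eq {d : ℕ} (D : LPData d) (k : ℕ) (x : RD d) :
    LPkernel D k x = (((2 : ℝ) ^ (k * d) : ℝ) : ℂ) * LPmother D k ((2 : ℝ) ^ k • x) := by
  cases k <;> simp [LPkernel, LPmother]

theorem LPhat_eq {d : ℕ} (D : LPData d) (k : ℕ) (ξ : RD d) :
    LPhat D k ξ = fourierS (LPmother D k) (((2 : ℝ) ^ k)⁻¹ • ξ) := by
  cases k <;> simp [LPhat, LPmother]

theorem fourierS_apply {d : ℕ} (f : 𝓢(RD d, ℂ)) (ξ : RD d) :
    fourierS f ξ = FourierTransform.fourier (⇑f) ξ := rfl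

theorem integrable_LPkernel {d : ℕ} (D : LPData d) (k : ℕ) : Integrable (LPkernel D k) := by
  have h : LPkernel D k = fun x => (((2 : ℝ) ^ (k * d) : ℝ) : ℂ) *
      LPmother D k ((2 : ℝ) ^ k • x) := funext (LPkernel_eq D k)
  rw [h]
  exact ((LPmother D k).integrable.comp_smul (by positivity)).const_mul _

/-- A common bound for the `L¹` norms of the Littlewood–Paley kernels. -/
def kernelMass {d : ℕ} (D : LPData d) : ℝ≥0∞ := (∫⁻ y, ‖D.Φ y‖ₑ) + ∫⁻ y, ‖D.φ y‖ₑ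

theorem kernelMass_ne_top {d : ℕ} (D : LPData d) : kernelMass D ≠ ⊤ :=
  ENNReal.add_ne_top.2 ⟨D.Φ.integrable.2.ne, D.φ.integrable.2.ne⟩

theorem lintegral_LPkernel_le {d : ℕ} (D : LPData d) (k : ℕ) :
    ∫⁻ y, ‖LPkernel D k y‖ₑ ≤ kernelMass D := by
  have h1 : ∫⁻ y, ‖LPkernel D k y‖ₑ = ∫⁻ y, ‖LPmother D k y‖ₑ := by
    rw [← ofReal_integral_norm_eq_lintegral_enorm (integrable_LPkernel D k),
      ← ofReal_integral_norm_eq_lintegral_enorm (LPmother D k).integrable]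
    congr 1
    simp_rw [LPkernel_eq, norm_mul, integral_const_mul]
    rw [Measure.integral_comp_smul volume (fun y : RD d => ‖LPmother D k y‖) ((2 : ℝ) ^ k),
      finrank_euclideanSpace_fin, Complex.norm_real, Real.norm_of_nonneg (by positivity),
      abs_of_nonneg (by positivity), smul_eq_mul, ← pow_mul,
      mul_inv_cancel_left₀ (by positivity)]
  rw [h1, kernelMass, LPmother]
  split_ifs
  · exact le_self_add
  · exact le_add_self

theorem LP_eq_convolution {d : ℕ} (D : LPData d) (k : ℕ) (g : RD d → ℂ) :
    LP D k g = MeasureTheory.convolution (LPkernel D k) g (ContinuousLinearMap.mul ℂ ℂ) volume := by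
  ext x
  simp [LP, MeasureTheory.convolution]

theorem integrable_LP {d : ℕ} (D : LPData d) (k : ℕ) (f : 𝓢(RD d, ℂ)) :
    Integrable (LP D k f) := by
  rw [LP_eq_convolution]
  exact (integrable_LPkernel D k).integrable_convolution _ f.integrable

theorem continuous_LP {d : ℕ} (D : LPData d) (k : ℕ) (f : 𝓢(RD d, ℂ)) :
    Continuous (LP D k f) := by
  rw [LP_eq_convolution]
  refine BddAbove.continuous_convolution_right_of_integrable _ ?_ (integrable_LPkernel D k)
    f.continuous
  obtain ⟨C, hC⟩ := f.decay 0 0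
  refine ⟨C, ?_⟩
  rintro _ ⟨x, rfl⟩
  simpa using hC.2 x

theorem fourier_LP {d : ℕ} (D : LPData d) (k : ℕ) (f : 𝓢(RD d, ℂ)) (ξ : RD d) :
    FourierTransform.fourier (LP D k f) ξ = LPhat D k ξ * fourierS f ξ := by
  rw [LP_eq_convolution, Real.fourier_mul_convolution_eq (integrable_LPkernel D k) f.integrable,
    LPhat_eq, fourierS_apply, fourierS_apply]
  congr 1
  have h : LPkernel D k = fun x => (((2 : ℝ) ^ (k * d) : ℝ)) •
      LPmother D k ((2 : ℝ) ^ k • x) := by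
    ext x
    rw [LPkernel_eq, Complex.real_smul]
  have h2 := fourier_comp_smul (LPmother D k) (R := (2 : ℝ) ^ k) (by positivity) ξ
  rw [Real.fourier_eq] at h2 ⊢
  simp_rw [h, smul_comm _ ((2 : ℝ) ^ (k * d)), integral_smul]
  rw [h2, ← pow_mul, smul_inv_smul₀ (by positivity)]

/-- `Φ̂` is supported in the ball of radius `2`. -/
theorem fourierS_Φ_eq_zero {d : ℕ} (D : LPData d) {ξ : RD d} (hξ : 2 < ‖ξ‖) :
    fourierS D.Φ ξ = 0 := by
  have hξ0 : ξ ≠ 0 := by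
    rintro rfl
    norm_num at hξ
  have hs := D.sum_φ ξ hξ0
  have hinj : Function.Injective (fun n : ℕ => ((n : ℤ) + 1)) := fun m n h => by
    simpa using h
  have hvan : ∀ k ∉ Set.range (fun n : ℕ => ((n : ℤ) + 1)),
      fourierS D.φ ((2 : ℝ) ^ (-k) • ξ) = 0 := by
    intro k hk
    by_contra hne
    have hk0 : k ≤ 0 := by
      by_contra! h
      exact hk ⟨(k - 1).toNat, by simp only; omega⟩
    have h2 := (D.supp_φ _ hne).2
    rw [norm_smul, Real.norm_of_nonneg (by positivity)] at h2
    have h1 : (1 : ℝ) ≤ 2 ^ (-k) := one_le_zpow₀ one_le_two (by omega)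
    nlinarith [norm_nonneg ξ]
  have hs' := (hinj.hasSum_iff hvan).2 hs
  rw [D.Φ_def, sub_eq_zero, ← hs'.tsum_eq]
  refine tsum_congr fun k => ?_
  simp only [Function.comp]
  congr 2

theorem norm_le_of_LPhat_ne_zero {d : ℕ} (D : LPData d) {k : ℕ} {ξ : RD d}
    (h : LPhat D k ξ ≠ 0) :
    ‖((2 : ℝ) ^ k)⁻¹ • ξ‖ ≤ 2 ∧ (k ≠ 0 → 1 / 2 ≤ ‖((2 : ℝ) ^ k)⁻¹ • ξ‖) := by
  rw [LPhat_eq, LPmother] at h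
  split_ifs at h with hk
  · refine ⟨?_, fun h0 => absurd hk h0⟩
    by_contra! h2
    exact h (fourierS_Φ_eq_zero D h2)
  · exact ⟨(D.supp_φ _ h).2, fun _ => (D.supp_φ _ h).1⟩

theorem continuous_LPhat {d : ℕ} (D : LPData d) (k : ℕ) : Continuous (LPhat D k) := by
  have h : LPhat D k = fun ξ => fourierS (LPmother D k) (((2 : ℝ) ^ k)⁻¹ • ξ) :=
    funext (LPhat_eq D k)
  rw [h]
  exact (fourierS (LPmother D k)).continuous.comp (continuous_const_smul _)

/-- Symbol estimates of order `s` with constant `K`, for derivatives up to order `N`. -/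
def SymbolBound {d : ℕ} (N : ℕ) (K s : ℝ) (b : RD d → ℂ) : Prop :=
  ContDiff ℝ ∞ b ∧
    ∀ p ≤ N, ∀ ξ, ‖iteratedFDeriv ℝ p b ξ‖ ≤ K * (1 + ‖ξ‖) ^ (s - (p : ℝ))

theorem SymbolBound.nonneg {d N : ℕ} {K s : ℝ} {b : RD d → ℂ} (h : SymbolBound N K s b) :
    0 ≤ K := by
  have := (norm_nonneg _).trans (h.2 0 (Nat.zero_le _) 0)
  simpa using this

theorem SymbolBound.add {d N : ℕ} {K K' s : ℝ} {b b' : RD d → ℂ} (h : SymbolBound N K s b)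
    (h' : SymbolBound N K' s b') : SymbolBound N (K + K') s (fun ξ => b ξ + b' ξ) := by
  refine ⟨h.1.add h'.1, fun p hp ξ => ?_⟩
  have hadd : iteratedFDeriv ℝ p (fun ξ => b ξ + b' ξ) ξ
      = iteratedFDeriv ℝ p b ξ + iteratedFDeriv ℝ p b' ξ :=
    iteratedFDeriv_add_apply (h.1.of_le (mod_cast le_top)).contDiffAt
      (h'.1.of_le (mod_cast le_top)).contDiffAt
  rw [hadd, add_mul]
  exact (norm_add_le _ _).trans (add_le_add (h.2 p hp ξ) (h'.2 p hp ξ))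

theorem SymbolBound.mul {d N : ℕ} {K K' s s' : ℝ} {b b' : RD d → ℂ} (h : SymbolBound N K s b)
    (h' : SymbolBound N K' s' b') :
    SymbolBound N (2 ^ N * (K * K')) (s + s') (fun ξ => b ξ * b' ξ) := by
  have hK := h.nonneg
  have hK' := h'.nonneg
  refine ⟨h.1.mul h'.1, fun p hp ξ => ?_⟩
  have ht : (0 : ℝ) < 1 + ‖ξ‖ := by positivity
  calc _ ≤ _ := norm_iteratedFDeriv_mul_le h.1 h'.1 ξ (n := p) (mod_cast le_top)
    _ ≤ ∑ i ∈ Finset.range (p + 1),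
        (p.choose i : ℝ) * (K * K' * (1 + ‖ξ‖) ^ (s + s' - (p : ℝ))) := by
      refine Finset.sum_le_sum fun i hi => ?_
      have hip : i ≤ p := Nat.lt_succ_iff.1 (Finset.mem_range.1 hi)
      have e : s + s' - (p : ℝ) = (s - (i : ℝ)) + (s' - ((p - i : ℕ) : ℝ)) := by
        rw [Nat.cast_sub hip]
        ring
      rw [mul_assoc, e, Real.rpow_add ht]
      refine mul_le_mul_of_nonneg_left ?_ (by positivity)
      calc _ ≤ (K * (1 + ‖ξ‖) ^ (s - (i : ℝ))) *
            (K' * (1 + ‖ξ‖) ^ (s' - ((p - i : ℕ) : ℝ))) :=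
            mul_le_mul (h.2 i (hip.trans hp) ξ) (h'.2 _ ((Nat.sub_le _ _).trans hp) ξ)
              (norm_nonneg _) (by positivity)
        _ = _ := by ring
    _ = 2 ^ p * (K * K' * (1 + ‖ξ‖) ^ (s + s' - (p : ℝ))) := by
      rw [← Finset.sum_mul]
      congr 1
      exact_mod_cast Nat.sum_range_choose p
    _ ≤ 2 ^ N * (K * K' * (1 + ‖ξ‖) ^ (s + s' - (p : ℝ))) := by
      gcongr
      exact one_le_two
    _ = _ := by ring

/-- Linear functions are symbols of order one. -/
theorem symbolBound_clm {d : ℕ} (N : ℕ) (L : RD d →L[ℝ] ℂ) : SymbolBound N ‖L‖ 1 L := by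
  refine ⟨L.contDiff, fun p _ ξ => ?_⟩
  rcases p with _ | _ | p
  · rw [norm_iteratedFDeriv_zero, Nat.cast_zero, sub_zero, Real.rpow_one]
    refine (L.le_opNorm ξ).trans ?_
    gcongr
    linarith
  · rw [zero_add, norm_iteratedFDeriv_one, L.fderiv]
    simp
  · rw [← norm_iteratedFDeriv_fderiv]
    have : fderiv ℝ L = fun _ => L := by
      ext x : 1
      exact L.fderiv
    rw [this, iteratedFDeriv_const_of_ne (Nat.succ_ne_zero p)]
    simp only [Pi.zero_apply, norm_zero]
    positivity

/-- Derivatives of a smooth compactly supported function are bounded up to a given order. -/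
theorem exists_norm_iteratedFDeriv_le {d : ℕ} (N : ℕ) {χ : RD d → ℂ} (hχ : ContDiff ℝ ∞ χ)
    (hc : HasCompactSupport χ) :
    ∃ E : ℝ, ∀ p ≤ N, ∀ ξ, ‖iteratedFDeriv ℝ p χ ξ‖ ≤ E := by
  have h : ∀ p : ℕ, ∃ E : ℝ, ∀ ξ, ‖iteratedFDeriv ℝ p χ ξ‖ ≤ E := fun p =>
    (hc.iteratedFDeriv (𝕜 := ℝ) p).exists_bound_of_continuous
      (hχ.continuous_iteratedFDeriv (mod_cast le_top))
  choose E hE using h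
  refine ⟨∑ p ∈ Finset.range (N + 1), |E p|, fun p hp ξ => ((hE p ξ).trans (le_abs_self _)).trans ?_⟩
  exact Finset.single_le_sum (f := fun p => |E p|) (fun _ _ => abs_nonneg _)
    (Finset.mem_range.2 (Nat.lt_succ_of_le hp))

/-- Smooth cutoffs adapted to the rescaled supports of the Littlewood–Paley multipliers, with
derivative bounds independent of the scale. -/
theorem exists_cutoff (d N : ℕ) : ∃ E : ℝ, ∀ k : ℕ, ∃ χ : RD d → ℂ, ContDiff ℝ ∞ χ ∧
    (∀ ξ ∈ tsupport χ, ‖ξ‖ ≤ 4 ∧ (k ≠ 0 → 1 / 4 ≤ ‖ξ‖)) ∧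
    (∀ p ≤ N, ∀ ξ, ‖iteratedFDeriv ℝ p χ ξ‖ ≤ E) ∧
    ∀ ξ, ‖ξ‖ ≤ 2 → (k ≠ 0 → 1 / 2 ≤ ‖ξ‖) → χ ξ = 1 := by
  let f₁ : ContDiffBump (0 : RD d) := ⟨2, 4, by norm_num, by norm_num⟩
  let f₂ : ContDiffBump (0 : RD d) := ⟨1 / 4, 1 / 2, by norm_num, by norm_num⟩
  let χ₁ : RD d → ℂ := fun ξ => (f₁ ξ : ℂ)
  let χ₂ : RD d → ℂ := fun ξ => (f₁ ξ : ℂ) - (f₂ ξ : ℂ)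
  have h₁ : ContDiff ℝ ∞ χ₁ := Complex.ofRealCLM.contDiff.comp f₁.contDiff
  have h₂ : ContDiff ℝ ∞ χ₂ := h₁.sub (Complex.ofRealCLM.contDiff.comp f₂.contDiff)
  have z₁ : ∀ ξ : RD d, 4 ≤ ‖ξ‖ → f₁ ξ = 0 := fun ξ h => f₁.zero_of_le_dist (by simpa using h)
  have z₂ : ∀ ξ : RD d, 1 / 2 ≤ ‖ξ‖ → f₂ ξ = 0 := fun ξ h =>
    f₂.zero_of_le_dist (by rwa [dist_zero_right])
  have o₁ : ∀ ξ : RD d, ‖ξ‖ ≤ 2 → f₁ ξ = 1 := fun ξ h =>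
    f₁.one_of_mem_closedBall (by simpa using h)
  have o₂ : ∀ ξ : RD d, ‖ξ‖ ≤ 1 / 4 → f₂ ξ = 1 := fun ξ h =>
    f₂.one_of_mem_closedBall (by rwa [mem_closedBall_zero_iff])
  have t₁ : tsupport χ₁ ⊆ {ξ | ‖ξ‖ ≤ 4} := by
    refine closure_minimal (fun ξ hξ => ?_) (isClosed_le continuous_norm continuous_const)
    by_contra! h
    exact hξ (by simp [χ₁, z₁ ξ (not_le.1 h).le])
  have t₂ : tsupport χ₂ ⊆ {ξ | ‖ξ‖ ≤ 4 ∧ 1 / 4 ≤ ‖ξ‖} := by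
    refine closure_minimal (fun ξ hξ => ⟨?_, ?_⟩) ((isClosed_le continuous_norm
      continuous_const).inter (isClosed_le continuous_const continuous_norm))
    · by_contra! h
      exact hξ (by simp [χ₂, z₁ ξ h.le, z₂ ξ (by linarith)])
    · by_contra! h
      exact hξ (by simp [χ₂, o₁ ξ (by linarith), o₂ ξ h.le])
  have c : ∀ χ : RD d → ℂ, tsupport χ ⊆ {ξ | ‖ξ‖ ≤ 4} → HasCompactSupport χ := fun χ h =>
    (isCompact_closedBall (0 : RD d) 4).of_isClosed_subset (isClosed_tsupport χ)
      fun ξ hξ => by simpa using h hξ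
  obtain ⟨E₁, hE₁⟩ := exists_norm_iteratedFDeriv_le N h₁ (c χ₁ t₁)
  obtain ⟨E₂, hE₂⟩ := exists_norm_iteratedFDeriv_le N h₂ (c χ₂ fun ξ hξ => (t₂ hξ).1)
  refine ⟨max E₁ E₂, fun k => ?_⟩
  by_cases hk : k = 0
  · exact ⟨χ₁, h₁, fun ξ hξ => ⟨t₁ hξ, fun h => absurd hk h⟩,
      fun p hp ξ => (hE₁ p hp ξ).trans (le_max_left _ _), fun ξ hξ _ => by simp [χ₁, o₁ ξ hξ]⟩
  · exact ⟨χ₂, h₂, fun ξ hξ => ⟨(t₂ hξ).1, fun _ => (t₂ hξ).2⟩,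
      fun p hp ξ => (hE₂ p hp ξ).trans (le_max_right _ _),
      fun ξ hξ h => by simp [χ₂, o₁ ξ hξ, z₂ ξ (h hk)]⟩

/-- A symbol of order `s`, localized to frequencies of size `2 ^ k` and rescaled to unit size,
has derivatives of size `2 ^ (k * s)`. -/
theorem SymbolBound.norm_iteratedFDeriv_rescaled_le {d N k : ℕ} {K s E : ℝ} {b χ : RD d → ℂ}
    (hb : SymbolBound N K s b) (hχ : ContDiff ℝ ∞ χ)
    (hsupp : ∀ ξ ∈ tsupport χ, ‖ξ‖ ≤ 4 ∧ (k ≠ 0 → 1 / 4 ≤ ‖ξ‖))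
    (hE : ∀ p ≤ N, ∀ ξ, ‖iteratedFDeriv ℝ p χ ξ‖ ≤ E) {p : ℕ} (hp : p ≤ N) (ξ : RD d) :
    ‖iteratedFDeriv ℝ p (fun ξ => b ((2 : ℝ) ^ k • ξ) * χ ξ) ξ‖
      ≤ 2 ^ N * 5 ^ (|s| + N) * E * K * ((2 : ℝ) ^ k) ^ s := by
  have hK := hb.nonneg
  have hE0 : 0 ≤ E := (norm_nonneg _).trans (hE 0 (Nat.zero_le _) 0)
  have hR : (0 : ℝ) < 2 ^ k := by positivity
  have hR1 : (1 : ℝ) ≤ 2 ^ k := one_le_pow₀ one_le_two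
  have hbk : ContDiff ℝ ∞ (fun ξ : RD d => b ((2 : ℝ) ^ k • ξ)) :=
    hb.1.comp (contDiff_const_smul _)
  by_cases hξ : ξ ∈ tsupport χ
  swap
  · have h0 : iteratedFDeriv ℝ p (fun ξ => b ((2 : ℝ) ^ k • ξ) * χ ξ) ξ = 0 := by
      by_contra h
      have := support_iteratedFDeriv_subset (𝕜 := ℝ) p h
      exact hξ (tsupport_mul_subset_right this)
    rw [h0, norm_zero]
    positivity
  obtain ⟨h4, hq⟩ := hsupp ξ hξ
  have hterm : ∀ i ≤ N, ‖iteratedFDeriv ℝ i (fun ξ : RD d => b ((2 : ℝ) ^ k • ξ)) ξ‖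
      ≤ 5 ^ (|s| + N) * K * ((2 : ℝ) ^ k) ^ s := by
    intro i hi
    rw [iteratedFDeriv_comp_const_smul _ (hb.1.of_le (mod_cast le_top))]
    simp only
    rw [norm_smul, Real.norm_of_nonneg (by positivity)]
    have h1 := hb.2 i hi ((2 : ℝ) ^ k • ξ)
    rw [norm_smul, Real.norm_of_nonneg hR.le] at h1
    set t : ℝ := 1 + 2 ^ k * ‖ξ‖ with ht
    have ht0 : 0 < t := by positivity
    set r : ℝ := t / 2 ^ k with hr
    have hr0 : 0 < r := by positivity
    have htr : t = 2 ^ k * r := by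
      rw [hr]
      field_simp
    have hr5 : r ≤ 5 := by
      rw [hr, div_le_iff₀ hR, ht]
      nlinarith
    have hr4 : 1 / 5 ≤ r := by
      rw [hr, le_div_iff₀ hR, ht]
      by_cases hk : k = 0
      · subst hk
        nlinarith [norm_nonneg ξ]
      · nlinarith [hq hk]
    have hrpow : r ^ (s - (i : ℝ)) ≤ 5 ^ (|s| + N) := by
      have hexp : |s - (i : ℝ)| ≤ |s| + N := by
        refine (abs_sub _ _).trans ?_
        rw [Nat.abs_cast]
        gcongr
      refine le_trans ?_ (Real.rpow_le_rpow_of_exponent_le (by norm_num) hexp)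
      rcases le_total 0 (s - (i : ℝ)) with h | h
      · rw [abs_of_nonneg h]
        exact Real.rpow_le_rpow hr0.le hr5 h
      · rw [abs_of_nonpos h, Real.rpow_neg (by norm_num), ← Real.inv_rpow (by norm_num)]
        exact Real.rpow_le_rpow_of_nonpos (by norm_num) (by simpa using hr4) h
    calc ((2 : ℝ) ^ k) ^ i * ‖iteratedFDeriv ℝ i b ((2 : ℝ) ^ k • ξ)‖
        ≤ ((2 : ℝ) ^ k) ^ i * (K * t ^ (s - (i : ℝ))) := by gcongr
      _ = K * (((2 : ℝ) ^ k) ^ (i : ℝ) * ((2 : ℝ) ^ k) ^ (s - (i : ℝ))) *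
            r ^ (s - (i : ℝ)) := by
          rw [htr, Real.mul_rpow hR.le hr0.le, Real.rpow_natCast]
          ring
      _ = K * ((2 : ℝ) ^ k) ^ s * r ^ (s - (i : ℝ)) := by
          rw [← Real.rpow_add hR, add_sub_cancel]
      _ ≤ K * ((2 : ℝ) ^ k) ^ s * 5 ^ (|s| + N) := by gcongr
      _ = _ := by ring
  calc _ ≤ _ := norm_iteratedFDeriv_mul_le hbk hχ ξ (n := p) (mod_cast le_top)
    _ ≤ ∑ i ∈ Finset.range (p + 1),
        (p.choose i : ℝ) * (5 ^ (|s| + N) * K * ((2 : ℝ) ^ k) ^ s * E) := by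
      refine Finset.sum_le_sum fun i hi => ?_
      have hip : i ≤ p := Nat.lt_succ_iff.1 (Finset.mem_range.1 hi)
      rw [mul_assoc]
      refine mul_le_mul_of_nonneg_left ?_ (by positivity)
      exact mul_le_mul (hterm i (hip.trans hp)) (hE _ ((Nat.sub_le _ _).trans hp) ξ)
        (norm_nonneg _) (by positivity)
    _ = 2 ^ p * (5 ^ (|s| + N) * K * ((2 : ℝ) ^ k) ^ s * E) := by
      rw [← Finset.sum_mul]
      congr 1
      exact_mod_cast Nat.sum_range_choose p
    _ ≤ 2 ^ N * (5 ^ (|s| + N) * K * ((2 : ℝ) ^ k) ^ s * E) := by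
      gcongr
      exact one_le_two
    _ = _ := by ring

/-- A Fourier multiplier of order `s` acting on a Littlewood–Paley piece is controlled by the
smooth average of that piece. -/
theorem exists_enorm_symbol_integral_le {d : ℕ} (D : LPData d) (s : ℝ) :
    ∃ C : ℝ, 0 ≤ C ∧ ∀ (k : ℕ) (K : ℝ) (b : RD d → ℂ) (f : 𝓢(RD d, ℂ)) (x : RD d),
      SymbolBound (2 * (d + 1)) K s b →
      ‖∫ ξ, b ξ * (LPhat D k ξ * fourierS f ξ) *
        Complex.exp (2 * Real.pi * Complex.I * ((⟪x, ξ⟫ : ℝ) : ℂ))‖ₑ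
      ≤ ENNReal.ofReal (C * K * ((2 : ℝ) ^ k) ^ s) *
          smoothAvg d k (fun z => ‖LP D k f z‖ₑ) x := by
  obtain ⟨E, hE⟩ := exists_cutoff d (2 * (d + 1))
  set N := 2 * (d + 1) with hN
  set F : ℝ := 2 ^ N * (1 + 2 ^ N * (N + 1)) * volume.real (Metric.closedBall (0 : RD d) 4)
  have hE0 : 0 ≤ E := by
    obtain ⟨χ, -, -, h, -⟩ := hE 0
    exact (norm_nonneg _).trans (h 0 (Nat.zero_le _) 0)
  refine ⟨F * (2 ^ N * 5 ^ (|s| + N) * E), by positivity, fun k K b f x hb => ?_⟩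
  obtain ⟨χ, hχ, hsupp, hEχ, hone⟩ := hE k
  have hR : (2 : ℝ) ^ k ≠ 0 := by positivity
  set H : RD d → ℂ := fun ξ => b ((2 : ℝ) ^ k • ξ) * χ ξ with hH
  have hHs : ContDiff ℝ ∞ H := (hb.1.comp (contDiff_const_smul _)).mul hχ
  have hHsupp : Function.support H ⊆ Metric.closedBall 0 4 := by
    intro ξ hξ
    have : χ ξ ≠ 0 := right_ne_zero_of_mul hξ
    simpa using (hsupp ξ (subset_tsupport _ this)).1
  have hHc : HasCompactSupport H :=
    HasCompactSupport.intro (isCompact_closedBall 0 4) fun x hx => by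
      by_contra h
      exact hx (hHsupp h)
  have hHint : Integrable H := hHs.continuous.integrable_of_hasCompactSupport hHc
  have hF := norm_fourier_le_of_norm_iteratedFDeriv_le N hHs hHsupp
    (fun p hp ξ => hb.norm_iteratedFDeriv_rescaled_le hχ hsupp hEχ hp ξ)
  have hmain := enorm_integral_multiplier_le_smoothAvg k hHint (integrable_LP D k f) hF x
  convert hmain using 3
  · ext ξ
    rw [fourier_LP]
    by_cases h0 : LPhat D k ξ = 0
    · simp [h0]
    · have hsz := norm_le_of_LPhat_ne_zero D h0
      simp only [hH]
      rw [smul_inv_smul₀ hR, hone _ hsz.1 hsz.2, mul_one]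
  · ring

theorem SymbolBound.mono {d N : ℕ} {K K' s : ℝ} {b : RD d → ℂ} (h : SymbolBound N K s b)
    (hK : K ≤ K') : SymbolBound N K' s b :=
  ⟨h.1, fun p hp ξ => (h.2 p hp ξ).trans (by gcongr)⟩

/-- The functions `a(z, ·)` are symbols of order `m`, uniformly in `z`. -/
theorem IsSymbolS11.exists_symbolBound {d : ℕ} {m : ℝ} {a : RD d → RD d → ℂ}
    (ha : IsSymbolS11 d m a) (N : ℕ) : ∃ K : ℝ, ∀ z, SymbolBound N K m (a z) := by
  choose c hc using fun α => ha.2 α 0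
  refine ⟨∑ p ∈ Finset.range (N + 1), |c p|, fun z =>
    ⟨ha.1.comp (contDiff_prodMk_right z), fun p hp ξ => ?_⟩⟩
  have h := hc p z ξ
  have he : (fun ξ' => iteratedFDeriv ℝ 0 (fun x' => a x' ξ') z)
      = (continuousMultilinearCurryFin0 ℝ (RD d) ℂ).symm ∘ a z := by
    ext ξ' : 1
    rw [iteratedFDeriv_zero_eq_comp]
    rfl
  rw [he, LinearIsometryEquiv.norm_iteratedFDeriv_comp_left, Nat.cast_zero, add_zero] at h
  refine h.trans ?_
  gcongr
  exact (le_abs_self _).trans (Finset.single_le_sum (f := fun p => |c p|)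
    (fun _ _ => abs_nonneg _) (Finset.mem_range.2 (Nat.lt_succ_of_le hp)))

/-- The directional `x`-derivatives of `a` are symbols of order `m + 1`, uniformly in `z`. -/
theorem IsSymbolS11.exists_symbolBound_fderiv {d : ℕ} {m : ℝ} {a : RD d → RD d → ℂ}
    (ha : IsSymbolS11 d m a) (N : ℕ) : ∃ K : ℝ, 0 ≤ K ∧ ∀ z v,
      SymbolBound N (K * ‖v‖) (m + 1) (fun ξ => fderiv ℝ (fun x => a x ξ) z v) := by
  choose c hc using fun α => ha.2 α 1
  refine ⟨∑ p ∈ Finset.range (N + 1), |c p|, Finset.sum_nonneg fun _ _ => abs_nonneg _,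
    fun z v => ?_⟩
  have hunc : ContDiff ℝ ∞ (Function.uncurry fun ξ x : RD d => a x ξ) :=
    ha.1.comp (contDiff_snd.prodMk contDiff_fst)
  have hfd : ContDiff ℝ ∞ (fun ξ => fderiv ℝ (fun x => a x ξ) z) :=
    hunc.fderiv contDiff_const (by simp)
  refine ⟨hfd.clm_apply contDiff_const, fun p hp ξ => ?_⟩
  have h := hc p z ξ
  have he : (fun ξ' => iteratedFDeriv ℝ 1 (fun x' => a x' ξ') z)
      = (continuousMultilinearCurryFin1 ℝ (RD d) ℂ).symm ∘
        fun ξ' => fderiv ℝ (fun x => a x ξ') z := by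
    ext ξ' w
    simp [iteratedFDeriv_one_apply]
  rw [he, LinearIsometryEquiv.norm_iteratedFDeriv_comp_left, Nat.cast_one] at h
  calc _ ≤ ‖v‖ * ‖iteratedFDeriv ℝ p (fun ξ' => fderiv ℝ (fun x => a x ξ') z) ξ‖ :=
        norm_iteratedFDeriv_clm_apply_const hfd.contDiffAt (mod_cast le_top)
    _ ≤ ‖v‖ * (c p * (1 + ‖ξ‖) ^ (m - (p : ℝ) + 1)) := by gcongr
    _ ≤ ‖v‖ * ((∑ p ∈ Finset.range (N + 1), |c p|) * (1 + ‖ξ‖) ^ (m - (p : ℝ) + 1)) := by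
        gcongr
        exact (le_abs_self _).trans (Finset.single_le_sum (f := fun p => |c p|)
          (fun _ _ => abs_nonneg _) (Finset.mem_range.2 (Nat.lt_succ_of_le hp)))
    _ = _ := by
        rw [show m - (p : ℝ) + 1 = m + 1 - (p : ℝ) by ring]
        ring

/-- The linear function `ξ ↦ 2πi⟨v, ξ⟩`. -/
def phaseCLM {d : ℕ} (v : RD d) : RD d →L[ℝ] ℂ :=
  (2 * Real.pi * Complex.I) • Complex.ofRealCLM.comp (innerSL ℝ v)

theorem phaseCLM_apply {d : ℕ} (v ξ : RD d) :
    phaseCLM v ξ = 2 * Real.pi * Complex.I * ((⟪v, ξ⟫ : ℝ) : ℂ) := rfl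

theorem norm_phaseCLM_le {d : ℕ} (v : RD d) : ‖phaseCLM v‖ ≤ 2 * Real.pi * ‖v‖ := by
  refine ContinuousLinearMap.opNorm_le_bound _ (by positivity) fun ξ => ?_
  rw [phaseCLM_apply, norm_mul, Complex.norm_real]
  have h := abs_real_inner_le_norm v ξ
  have h2 : ‖(2 * Real.pi * Complex.I : ℂ)‖ = 2 * Real.pi := by
    simp [abs_of_pos Real.pi_pos]
  rw [h2, mul_assoc (2 * Real.pi), Real.norm_eq_abs]
  gcongr

theorem norm_exp_phase {d : ℕ} (x ξ : RD d) :
    ‖Complex.exp (2 * Real.pi * Complex.I * ((⟪x, ξ⟫ : ℝ) : ℂ))‖ = 1 := by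
  rw [show (2 * Real.pi * Complex.I * ((⟪x, ξ⟫ : ℝ) : ℂ))
    = ((2 * Real.pi * ⟪x, ξ⟫ : ℝ) : ℂ) * Complex.I by push_cast; ring, norm_exp_ofReal_mul_I]

/-- The symbol of the directional derivative of `x ↦ a(x, D)`. -/
def derivSymbol {d : ℕ} (a : RD d → RD d → ℂ) (z v ξ : RD d) : ℂ :=
  fderiv ℝ (fun x => a x ξ) z v + phaseCLM v ξ * a z ξ

theorem IsSymbolS11.exists_symbolBound_derivSymbol {d : ℕ} {m : ℝ} {a : RD d → RD d → ℂ}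
    (ha : IsSymbolS11 d m a) (N : ℕ) : ∃ K : ℝ, 0 ≤ K ∧ ∀ z v,
      SymbolBound N (K * ‖v‖) (m + 1) (derivSymbol a z v) := by
  obtain ⟨K₀, h₀⟩ := ha.exists_symbolBound N
  obtain ⟨K₁, hK₁, h₁⟩ := ha.exists_symbolBound_fderiv N
  have hK₀ := (h₀ 0).nonneg
  refine ⟨K₁ + 2 ^ N * (2 * Real.pi * K₀), by positivity, fun z v => ?_⟩
  have h := (h₁ z v).add (((symbolBound_clm N (phaseCLM v)).mul (h₀ z)).mono
    (K' := 2 ^ N * (2 * Real.pi * K₀) * ‖v‖) ?_ |> fun h => add_comm 1 m ▸ h)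
  · rw [← add_mul] at h
    exact h
  · calc 2 ^ N * (‖phaseCLM v‖ * K₀) ≤ 2 ^ N * (2 * Real.pi * ‖v‖ * K₀) := by
          gcongr
          exact norm_phaseCLM_le v
      _ = _ := by ring

/-- The Fourier multiplier with symbol `b` applied to the `k`-th Littlewood–Paley piece. -/
def frequencyPiece {d : ℕ} (D : LPData d) (k : ℕ) (b : RD d → ℂ) (f : 𝓢(RD d, ℂ)) (x : RD d) : ℂ :=
  ∫ ξ, b ξ * (LPhat D k ξ * fourierS f ξ) *
    Complex.exp (2 * Real.pi * Complex.I * ((⟪x, ξ⟫ : ℝ) : ℂ))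

theorem integrable_envelope {d : ℕ} (D : LPData d) (k : ℕ) (f : 𝓢(RD d, ℂ)) (K s : ℝ) :
    Integrable (fun ξ => K * (1 + ‖ξ‖) ^ s * ‖LPhat D k ξ * fourierS f ξ‖) := by
  refine Continuous.integrable_of_hasCompactSupport ?_ ?_
  · refine (continuous_const.mul (Continuous.rpow_const (by fun_prop) fun ξ => Or.inl ?_)).mul
      ((continuous_LPhat D k).mul (fourierS f).continuous).norm
    positivity
  · refine HasCompactSupport.intro (isCompact_closedBall 0 (2 ^ k * 2)) fun ξ hξ => ?_
    have h0 : LPhat D k ξ = 0 := by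
      by_contra h
      have h2 := (norm_le_of_LPhat_ne_zero D h).1
      rw [norm_smul, norm_inv, Real.norm_of_nonneg (by positivity), inv_mul_le_iff₀ (by positivity)]
        at h2
      exact hξ (by simpa using h2)
    simp [h0]

theorem SymbolBound.norm_le {d N : ℕ} {K s : ℝ} {b : RD d → ℂ} (h : SymbolBound N K s b)
    (ξ : RD d) : ‖b ξ‖ ≤ K * (1 + ‖ξ‖) ^ s := by
  simpa using h.2 0 (Nat.zero_le _) ξ

/-- The derivative of `t ↦ T_{a(z + tv, ·)} f (x + tv)` on a Littlewood–Paley piece. -/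
theorem IsSymbolS11.hasDerivAt_frequencyPiece {d : ℕ} {m : ℝ} {a : RD d → RD d → ℂ}
    (ha : IsSymbolS11 d m a) (D : LPData d) (k : ℕ) (f : 𝓢(RD d, ℂ)) (z x v : RD d) (t : ℝ) :
    HasDerivAt (fun t : ℝ => frequencyPiece D k (a (z + t • v)) f (x + t • v))
      (frequencyPiece D k (derivSymbol a (z + t • v) v) f (x + t • v)) t := by
  obtain ⟨K₀, h₀⟩ := ha.exists_symbolBound 0
  obtain ⟨K₁, hK₁, h₁⟩ := ha.exists_symbolBound_derivSymbol 0
  set g : RD d → ℂ := fun ξ => LPhat D k ξ * fourierS f ξ with hg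
  have hgc : Continuous g := (continuous_LPhat D k).mul (fourierS f).continuous
  have hexp : ∀ y : RD d, Continuous fun ξ : RD d =>
      Complex.exp (2 * Real.pi * Complex.I * ((⟪y, ξ⟫ : ℝ) : ℂ)) := fun y => by fun_prop
  have hF : ∀ t : ℝ, Continuous fun ξ => a (z + t • v) ξ * g ξ *
      Complex.exp (2 * Real.pi * Complex.I * ((⟪x + t • v, ξ⟫ : ℝ) : ℂ)) := fun t =>
    ((h₀ _).1.continuous.mul hgc).mul (hexp _)
  have hF' : ∀ t : ℝ, Continuous fun ξ => derivSymbol a (z + t • v) v ξ * g ξ *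
      Complex.exp (2 * Real.pi * Complex.I * ((⟪x + t • v, ξ⟫ : ℝ) : ℂ)) := fun t =>
    ((h₁ _ _).1.continuous.mul hgc).mul (hexp _)
  refine (hasDerivAt_integral_of_dominated_loc_of_deriv_le (s := Set.univ)
    (bound := fun ξ => K₁ * ‖v‖ * (1 + ‖ξ‖) ^ (m + 1) * ‖g ξ‖)
    (F' := fun (t : ℝ) ξ => derivSymbol a (z + t • v) v ξ * g ξ *
      Complex.exp (2 * Real.pi * Complex.I * ((⟪x + t • v, ξ⟫ : ℝ) : ℂ))) univ_mem
    (Eventually.of_forall fun t => (hF t).aestronglyMeasurable) ?_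
    (hF' t).aestronglyMeasurable (ae_of_all _ fun ξ t _ => ?_)
    (integrable_envelope D k f (K₁ * ‖v‖) (m + 1)) (ae_of_all _ fun ξ t _ => ?_)).2
  · refine (integrable_envelope D k f K₀ m).mono' (hF t).aestronglyMeasurable
      (ae_of_all _ fun ξ => ?_)
    rw [norm_mul, norm_mul, norm_exp_phase, mul_one]
    exact mul_le_mul_of_nonneg_right ((h₀ _).norm_le ξ) (norm_nonneg _)
  · rw [norm_mul, norm_mul, norm_exp_phase, mul_one]
    exact mul_le_mul_of_nonneg_right ((h₁ _ _).norm_le ξ) (norm_nonneg _)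
  · have hline : HasDerivAt (fun t : ℝ => z + t • v) v t := by
      simpa using ((hasDerivAt_id t).smul_const v).const_add z
    have hax : ContDiff ℝ ∞ (fun y => a y ξ) := ha.1.comp (contDiff_prodMk_left ξ)
    have h1 : HasDerivAt (fun t : ℝ => a (z + t • v) ξ)
        (fderiv ℝ (fun y => a y ξ) (z + t • v) v) t :=
      ((hax.differentiable (by simp)) _).hasFDerivAt.comp_hasDerivAt t hline
    have h2 : HasDerivAt (fun t : ℝ => 2 * Real.pi * Complex.I * ((⟪x + t • v, ξ⟫ : ℝ) : ℂ))
        (phaseCLM v ξ) t := by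
      have h3 : (fun t : ℝ => 2 * Real.pi * Complex.I * ((⟪x + t • v, ξ⟫ : ℝ) : ℂ))
          = fun t : ℝ => phaseCLM x ξ + (t : ℂ) * phaseCLM v ξ := by
        ext t
        rw [phaseCLM_apply, phaseCLM_apply, inner_add_left, real_inner_smul_left]
        push_cast
        ring
      rw [h3]
      simpa using ((hasDerivAt_id t).ofReal_comp.mul_const (phaseCLM v ξ)).const_add (phaseCLM x ξ)
    refine ((h1.mul_const (g ξ)).mul h2.cexp).congr_deriv ?_
    simp only [derivSymbol]
    ring

/-- Interchanging the convolution in `x` with the frequency integral. -/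
theorem IsSymbolS11.pdo_symbolPiece_eq {d : ℕ} {m : ℝ} {a : RD d → RD d → ℂ}
    (ha : IsSymbolS11 d m a) (D : LPData d) (j k : ℕ) (f : 𝓢(RD d, ℂ)) (x : RD d) :
    Integrable (fun y => LPkernel D j y * frequencyPiece D k (a (x - y)) f x) ∧
    pdo (symbolPiece D a j k) f x =
      ∫ y, LPkernel D j y * frequencyPiece D k (a (x - y)) f x := by
  obtain ⟨K, hK⟩ := ha.exists_symbolBound 0
  set F : RD d → RD d → ℂ := fun y ξ => LPkernel D j y * (a (x - y) ξ *
    (LPhat D k ξ * fourierS f ξ) *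
      Complex.exp (2 * Real.pi * Complex.I * ((⟪x, ξ⟫ : ℝ) : ℂ))) with hF
  have hInt : Integrable (Function.uncurry F) := by
    refine ((integrable_LPkernel D j).norm.mul_prod (integrable_envelope D k f K m)).mono' ?_
      (ae_of_all _ fun p => ?_)
    · refine (integrable_LPkernel D j).aestronglyMeasurable.comp_fst.mul ?_
      refine Continuous.aestronglyMeasurable ?_
      have h1 : Continuous fun p : RD d × RD d => a (x - p.1) p.2 :=
        ha.1.continuous.comp ((continuous_const.sub continuous_fst).prodMk continuous_snd)
      have h2 := (continuous_LPhat D k).comp (continuous_snd (X := RD d) (Y := RD d))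
      have h3 := (fourierS f).continuous.comp (continuous_snd (X := RD d) (Y := RD d))
      exact (h1.mul (h2.mul h3)).mul (by fun_prop)
    · simp only [Function.uncurry, hF]
      rw [norm_mul, norm_mul, norm_mul (a _ _), norm_exp_phase, mul_one]
      gcongr
      exact (hK _).norm_le p.2
  have hfp : ∀ y, ∫ ξ, F y ξ = LPkernel D j y * frequencyPiece D k (a (x - y)) f x := fun y => by
    simp only [hF]
    rw [integral_const_mul, frequencyPiece]
  refine ⟨?_, ?_⟩
  · have := hInt.integral_prod_left
    simpa only [Function.uncurry, hfp] using this
  · simp_rw [← hfp]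
    rw [integral_integral_swap hInt, pdo]
    congr 1
    ext ξ
    have : ∀ y, F y ξ = LPkernel D j y * a (x - y) ξ * (LPhat D k ξ * fourierS f ξ *
        Complex.exp (2 * Real.pi * Complex.I * ((⟪x, ξ⟫ : ℝ) : ℂ))) := fun y => by
      simp only [hF]
      ring
    simp_rw [this]
    rw [integral_mul_const, symbolPiece]
    ring

/-- Size and Lipschitz estimates for the pieces `T_{a_{j,k}} f`. -/
theorem IsSymbolS11.exists_enorm_pdo_symbolPiece_le {d : ℕ} {m : ℝ} {a : RD d → RD d → ℂ}
    (ha : IsSymbolS11 d m a) (D : LPData d) : ∃ C : ℝ≥0∞, C ≠ ⊤ ∧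
      (∀ (j k : ℕ) (f : 𝓢(RD d, ℂ)) (x : RD d), ‖pdo (symbolPiece D a j k) f x‖ₑ
        ≤ C * (ENNReal.ofReal (((2 : ℝ) ^ k) ^ m) * smoothAvg d k (fun z => ‖LP D k f z‖ₑ) x)) ∧
      ∀ (j k : ℕ) (f : 𝓢(RD d, ℂ)) (S : ℝ≥0∞), S ≠ ⊤ →
        (∀ x, ENNReal.ofReal (((2 : ℝ) ^ k) ^ m) *
          smoothAvg d k (fun z => ‖LP D k f z‖ₑ) x ≤ S) →
        ∀ x x', ‖pdo (symbolPiece D a j k) f x - pdo (symbolPiece D a j k) f x'‖ₑ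
          ≤ C * S * 2 ^ k * ‖x - x'‖ₑ := by
  obtain ⟨K₀, h₀⟩ := ha.exists_symbolBound (2 * (d + 1))
  obtain ⟨K₁, hK₁, h₁⟩ := ha.exists_symbolBound_derivSymbol (2 * (d + 1))
  obtain ⟨C₀, hC₀, hb₀⟩ := exists_enorm_symbol_integral_le D m
  obtain ⟨C₁, hC₁, hb₁⟩ := exists_enorm_symbol_integral_le D (m + 1)
  have hK₀ := (h₀ 0).nonneg
  set C : ℝ := max (C₀ * K₀) (C₁ * K₁) with hC
  have hC0 : 0 ≤ C := le_max_of_le_left (by positivity)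
  have hav : ∀ (j : ℕ) (u : RD d → ℂ) (B : ℝ≥0∞), (∀ y, ‖u y‖ₑ ≤ B) →
      ‖∫ y, LPkernel D j y * u y‖ₑ ≤ kernelMass D * B := by
    intro j u B hu
    calc _ ≤ ∫⁻ y, ‖LPkernel D j y * u y‖ₑ := enorm_integral_le_lintegral_enorm _
      _ ≤ ∫⁻ y, ‖LPkernel D j y‖ₑ * B := by
          refine lintegral_mono fun y => ?_
          rw [enorm_mul]
          gcongr
          exact hu y
      _ = (∫⁻ y, ‖LPkernel D j y‖ₑ) * B :=
          lintegral_mul_const'' _ (integrable_LPkernel D j).aestronglyMeasurable.enorm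
      _ ≤ _ := by
          gcongr
          exact lintegral_LPkernel_le D j
  refine ⟨kernelMass D * ENNReal.ofReal C,
    ENNReal.mul_ne_top (kernelMass_ne_top D) ENNReal.ofReal_ne_top, ?_, ?_⟩
  · intro j k f x
    rw [(ha.pdo_symbolPiece_eq D j k f x).2, mul_assoc]
    refine hav j _ _ fun y => (hb₀ k K₀ _ f x (h₀ (x - y))).trans ?_
    rw [← mul_assoc, ← ENNReal.ofReal_mul hC0]
    gcongr
    exact le_max_left _ _
  · intro j k f S hS hbound x x'
    have hdiff : pdo (symbolPiece D a j k) f x - pdo (symbolPiece D a j k) f x'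
        = ∫ y, LPkernel D j y * (frequencyPiece D k (a (x - y)) f x
          - frequencyPiece D k (a (x' - y)) f x') := by
      obtain ⟨i₁, e₁⟩ := ha.pdo_symbolPiece_eq D j k f x
      obtain ⟨i₂, e₂⟩ := ha.pdo_symbolPiece_eq D j k f x'
      rw [e₁, e₂, ← integral_sub i₁ i₂]
      simp_rw [mul_sub]
    rw [hdiff, mul_assoc, mul_assoc, mul_assoc]
    refine hav j _ _ fun y => ?_
    set v := x - x' with hv
    have hderiv : ∀ t : ℝ, ‖frequencyPiece D k (derivSymbol a (x' - y + t • v) v) f (x' + t • v)‖ₑ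
        ≤ ENNReal.ofReal C * (S * (2 ^ k * ‖v‖ₑ)) := by
      intro t
      refine (hb₁ k _ _ f (x' + t • v) (h₁ (x' - y + t • v) v)).trans ?_
      have hsplit : C₁ * (K₁ * ‖v‖) * ((2 : ℝ) ^ k) ^ (m + 1)
          = C₁ * K₁ * (((2 : ℝ) ^ k) ^ m * (2 ^ k * ‖v‖)) := by
        rw [Real.rpow_add (by positivity), Real.rpow_one]
        ring
      have h2 : (2 : ℝ≥0∞) ^ k = ENNReal.ofReal ((2 : ℝ) ^ k) := by
        rw [ENNReal.ofReal_pow zero_le_two, ENNReal.ofReal_ofNat]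
      rw [hsplit, ENNReal.ofReal_mul (p := C₁ * K₁) (by positivity),
        ENNReal.ofReal_mul (p := ((2 : ℝ) ^ k) ^ m) (by positivity),
        ENNReal.ofReal_mul (p := (2 : ℝ) ^ k) (by positivity), ← h2, ofReal_norm]
      calc _ = ENNReal.ofReal (C₁ * K₁) * ((ENNReal.ofReal (((2 : ℝ) ^ k) ^ m) *
            smoothAvg d k (fun z => ‖LP D k f z‖ₑ) (x' + t • v)) * (2 ^ k * ‖v‖ₑ)) := by ring
        _ ≤ _ := by
          gcongr
          · exact le_max_right _ _
          · exact hbound _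
    have hfin : ENNReal.ofReal C * (S * (2 ^ k * ‖v‖ₑ)) ≠ ⊤ := by
      refine ENNReal.mul_ne_top ENNReal.ofReal_ne_top (ENNReal.mul_ne_top hS
        (ENNReal.mul_ne_top (by simp) enorm_ne_top))
    have hmv := norm_image_sub_le_of_norm_deriv_le_segment_01'
      (fun t _ => (ha.hasDerivAt_frequencyPiece D k f (x' - y) x' v t).hasDerivWithinAt)
      (C := (ENNReal.ofReal C * (S * (2 ^ k * ‖v‖ₑ))).toReal) fun t _ => by
        rw [← toReal_enorm]
        exact ENNReal.toReal_mono hfin (hderiv t)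
    simp only [one_smul, zero_smul, add_zero] at hmv
    rw [show x' - y + v = x - y by rw [hv]; abel, show x' + v = x by rw [hv]; abel] at hmv
    rw [← ofReal_norm]
    exact ENNReal.ofReal_le_of_le_toReal hmv

theorem smoothAvg_const_mul {d k : ℕ} {c : ℝ≥0∞} (hc : c ≠ ⊤) (G : RD d → ℝ≥0∞) (x : RD d) :
    smoothAvg d k (fun z => c * G z) x = c * smoothAvg d k G x := by
  rw [smoothAvg, smoothAvg, ← lintegral_const_mul' _ _ hc]
  congr 1
  ext z
  ring

/-- The weighted Littlewood–Paley piece `2 ^ (k * m) * |Π_k f|`. -/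
def weightedPiece {d : ℕ} (D : LPData d) (m : ℝ) (f : 𝓢(RD d, ℂ)) (k : ℕ) (z : RD d) : ℝ≥0∞ :=
  ENNReal.ofReal (((2 : ℝ) ^ k) ^ m) * ‖LP D k f z‖ₑ

theorem measurable_weightedPiece {d : ℕ} (D : LPData d) (m : ℝ) (f : 𝓢(RD d, ℂ)) (k : ℕ) :
    Measurable (weightedPiece D m f k) :=
  (continuous_LP D k f).enorm.measurable.const_mul _

theorem cubePiece_one_eq {d : ℕ} (D : LPData d) (m : ℝ) (f : 𝓢(RD d, ℂ)) (μ : ℕ)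
    (n : Fin d → ℤ) : cubePiece d μ n μ m 1 (fun k x => LP D k f x)
      = 2 ^ (μ * d) * ∫⁻ x in dyadicCube d μ n, ∑' j, weightedPiece D m f (μ + j) x := by
  have h2 : (2 : ℝ≥0∞) ^ ((μ : ℝ) * (d : ℝ)) = 2 ^ (μ * d) := by
    rw [← ENNReal.rpow_natCast]
    push_cast
    rfl
  have hj : ∀ j : ℕ, (2 : ℝ≥0∞) ^ (m * ((μ : ℝ) + (j : ℝ)) * 1)
      = ENNReal.ofReal (((2 : ℝ) ^ (μ + j)) ^ m) := by
    intro j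
    rw [← Real.rpow_natCast, ← Real.rpow_mul zero_le_two, ← ENNReal.ofReal_rpow_of_pos zero_lt_two,
      ENNReal.ofReal_ofNat]
    push_cast
    congr 1
    ring
  rw [cubePiece, h2, div_one, ENNReal.rpow_one]
  simp_rw [hj, ENNReal.rpow_one]
  rfl

theorem lintegral_weightedPiece_le {d : ℕ} (D : LPData d) (m : ℝ) (f : 𝓢(RD d, ℂ)) {μ : ℕ}
    (hμ : 1 ≤ μ) (n : Fin d → ℤ) :
    2 ^ (μ * d) * ∫⁻ x in dyadicCube d μ n, ∑' j, weightedPiece D m f (μ + j) x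
      ≤ FinftyNormFun D m 1 f := by
  rw [← cubePiece_one_eq, FinftyNormFun]
  refine le_trans ?_ le_add_self
  exact le_iSup_of_le μ (le_iSup_of_le hμ (le_iSup_of_le n le_rfl))

theorem smoothAvg_weightedPiece_le {d : ℕ} (D : LPData d) (m : ℝ) (f : 𝓢(RD d, ℂ)) (k : ℕ)
    (x : RD d) : smoothAvg d k (weightedPiece D m f k) x
      ≤ (avgConst d + weightMass d) * FinftyNormFun D m 1 f := by
  rw [add_mul]
  rcases Nat.eq_zero_or_pos k with rfl | hk
  · refine (smoothAvg_le_of_le (fun z => ?_) x).trans le_add_self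
    rw [weightedPiece, pow_zero, Real.one_rpow, ENNReal.ofReal_one, one_mul]
    exact (le_iSup (fun z => ‖LP D 0 f z‖ₑ) z).trans le_self_add
  · refine (smoothAvg_le (measurable_weightedPiece D m f k) (fun n => ?_) x).trans le_self_add
    refine le_trans ?_ (lintegral_weightedPiece_le D m f hk n)
    gcongr with z
    exact ENNReal.le_tsum (f := fun j => weightedPiece D m f (k + j) z) 0

/-- the near-diagonal part maps `F_∞^{m,1}` into `bmo`:
`‖S^{near}_a f‖_{bmo} ≤ C ‖f‖_{F_∞^{m,1}}`. -/
theorem statement18 (d : ℕ) (hd : 1 ≤ d) (m : ℝ)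
    (D : LPData d) (a : RD d → RD d → ℂ) (ha : IsSymbolS11 d m a) :
    ∃ C : ℝ≥0, ∀ f : 𝓢(RD d, ℂ),
      bmoNorm d (Snear D a f) ≤ (C : ℝ≥0∞) * FinftyNormFun D m 1 (⇑f) := by
  obtain ⟨C, hC, hsize, hlip⟩ := ha.exists_enorm_pdo_symbolPiece_le D
  set W : ℝ≥0∞ := avgConst d + weightMass d + cubeConst d with hW
  have hWtop : W ≠ ⊤ := by
    simp [hW, avgConst_ne_top, weightMass_ne_top, cubeConst_ne_top]
  set K : ℝ≥0∞ := (5 * (1 + 3 ^ d) + 2 * (5 * (2 * d + 1))) * (C * W) + 1 with hK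
  have hKtop : K ≠ ⊤ := by
    refine ENNReal.add_ne_top.2 ⟨ENNReal.mul_ne_top ?_ (ENNReal.mul_ne_top hC hWtop),
      ENNReal.one_ne_top⟩
    norm_cast
    exact ENNReal.natCast_ne_top _
  refine ⟨K.toNNReal, fun f => ?_⟩
  rw [ENNReal.coe_toNNReal hKtop]
  set A := FinftyNormFun D m 1 f with hAdef
  by_cases hA : A = ⊤
  · rw [hA, ENNReal.mul_top (by simp [hK])]
    exact le_top
  have hsplit : ∀ k x, ENNReal.ofReal (((2 : ℝ) ^ k) ^ m) *
      smoothAvg d k (fun z => ‖LP D k f z‖ₑ) x = smoothAvg d k (weightedPiece D m f k) x :=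
    fun k x => (smoothAvg_const_mul ENNReal.ofReal_ne_top _ x).symm
  have havg : ∀ k x, smoothAvg d k (weightedPiece D m f k) x ≤ W * A := fun k x =>
    (smoothAvg_weightedPiece_le D m f k x).trans (by gcongr; exact le_self_add)
  have hmain := bmoNorm_tsum_le
    (G := fun p x => if |(p.1 : ℤ) - (p.2 : ℤ)| ≤ 2 then pdo (symbolPiece D a p.1 p.2) f x else 0)
    (B := fun k x => C * smoothAvg d k (weightedPiece D m f k) x) (A := C * (W * A))
    (ENNReal.mul_ne_top hC (ENNReal.mul_ne_top hWtop hA))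
    (fun k => (measurable_smoothAvg (measurable_weightedPiece D m f k)).const_mul _)
    (fun p x hp => if_neg hp) (fun p x => ?_) (fun x => by gcongr; exact havg 0 x)
    (fun p x y => ?_) (fun μ hμ c L hL0 hL => ?_)
  · refine hmain.trans ?_
    calc _ = (5 * (1 + 3 ^ d) + 2 * (5 * (2 * d + 1))) * (C * W) * A := by ring
      _ ≤ K * A := by
        gcongr
        exact le_self_add
  · split_ifs
    · exact (hsize p.1 p.2 f x).trans_eq (by rw [hsplit])
    · simp
  · split_ifs
    · exact hlip p.1 p.2 f (W * A) (ENNReal.mul_ne_top hWtop hA)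
        (fun x => (hsplit _ x).trans_le (havg _ x)) x y
    · simp
  · simp_rw [ENNReal.tsum_mul_left]
    rw [lintegral_const_mul' _ _ hC, mul_left_comm]
    refine mul_le_mul_right ((lintegral_cube_smoothAvg_le (measurable_weightedPiece D m f)
      (fun n => lintegral_weightedPiece_le D m f hμ n) c hL0 hL).trans ?_) C
    gcongr
    exact le_add_self

end
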